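/- arXiv:2001.10670 — 13 statements merged into one kernel-verified Lean document; each statement's English description precedes it below -/
import Mathlib

section
/- Let X ⊆ ℝ² be open, let f : X → ℝ be locally Lipschitz continuous, and let V ∈ ℝ^{2×2} be a nonsingular matrix with columns v₁, v₂. If f is directionally differentiable at some x ∈ X, then the vector ½·(Vᵀ)⁻¹·( f'(x;v₁) − f'(x;−v₁), f'(x;v₂) − f'(x;−v₂) ) is an element of Clarke's generalized gradient ∂f(x). -/
open Filter Topology Set
open scoped RealInnerProductSpace

noncomputable section

/-- `f` has one-sided directional derivative `L` at `x` in direction `d`: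
`L = lim_{t→0⁺} (f(x+td) − f(x))/t`. -/
def HasDirDeriv {E : Type*} [NormedAddCommGroup E] [NormedSpace ℝ E]
    (f : E → ℝ) (x d : E) (L : ℝ) : Prop :=
  Tendsto (fun t : ℝ => (f (x + t • d) - f x) / t) (𝓝[>] (0 : ℝ)) (𝓝 L)

/-- `f` is directionally differentiable at `x`: the one-sided directional derivative
exists (finite) in every direction. -/
def DirDiffAt {E : Type*} [NormedAddCommGroup E] [NormedSpace ℝ E]
    (f : E → ℝ) (x : E) : Prop :=
  ∀ d : E, ∃ L : ℝ, HasDirDeriv f x d L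

/-- The one-sided directional derivative `f'(x;d)`. -/
def dirDeriv {E : Type*} [NormedAddCommGroup E] [NormedSpace ℝ E]
    (f : E → ℝ) (x d : E) : ℝ :=
  limUnder (𝓝[>] (0 : ℝ)) (fun t : ℝ => (f (x + t • d) - f x) / t)

/-- The Clarke generalized directional derivative
`f°(x;d) = limsup_{y→x, t→0⁺} (f(y+td) − f(y))/t`. -/
def clarkeDD {E : Type*} [NormedAddCommGroup E] [NormedSpace ℝ E]
    (f : E → ℝ) (x d : E) : ℝ :=
  limsup (fun q : E × ℝ => (f (q.1 + q.2 • d) - f q.1) / q.2)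
    ((𝓝 x) ×ˢ (𝓝[>] (0 : ℝ)))

/-- Clarke's generalized gradient `∂f(x) = {s : ⟨s,d⟩ ≤ f°(x;d) ∀ d}`. -/
def clarkeGrad {F : Type*} [NormedAddCommGroup F] [InnerProductSpace ℝ F]
    (f : F → ℝ) (x : F) : Set F :=
  {s : F | ∀ d : F, ⟪s, d⟫ ≤ clarkeDD f x d}

/-- `f` is locally Lipschitz continuous on `X`. -/
def LocLipOn {E : Type*} [NormedAddCommGroup E] [NormedSpace ℝ E]
    (f : E → ℝ) (X : Set E) : Prop :=
  ∀ x ∈ X, ∃ K : NNReal, ∃ U ∈ 𝓝 x, LipschitzOnWith K f U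

/-- The `i`-th standard unit vector of `ℝ²`. -/
def e2 (i : Fin 2) : EuclideanSpace ℝ (Fin 2) := EuclideanSpace.single i 1

/-- The compass difference
`D⋄f(x) = ½·(f'(x;e₁) − f'(x;−e₁), f'(x;e₂) − f'(x;−e₂))`. -/
def compassDiff (f : EuclideanSpace ℝ (Fin 2) → ℝ) (x : EuclideanSpace ℝ (Fin 2)) :
    EuclideanSpace ℝ (Fin 2) :=
  ∑ i : Fin 2, ((dirDeriv f x (e2 i) - dirDeriv f x (-(e2 i))) / 2) • e2 i


theorem clarke_bdd {E : Type*} [NormedAddCommGroup E] [NormedSpace ℝ E]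
    (f : E → ℝ) (x d : E) (K : NNReal) (U : Set E) (hU : U ∈ 𝓝 x) (hK : LipschitzOnWith K f U) :
    IsBoundedUnder (· ≤ ·) ((𝓝 x) ×ˢ (𝓝[>] (0 : ℝ)))
      (fun q : E × ℝ => (f (q.1 + q.2 • d) - f q.1) / q.2) := by
  have h1 : Tendsto (fun q : E × ℝ => q.1) ((𝓝 x) ×ˢ (𝓝[>] (0 : ℝ))) (𝓝 x) := tendsto_fst
  have h2 : Tendsto (fun q : E × ℝ => q.2) ((𝓝 x) ×ˢ (𝓝[>] (0 : ℝ))) (𝓝[>] 0) := tendsto_snd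
  have h3 : Tendsto (fun q : E × ℝ => q.1 + q.2 • d) ((𝓝 x) ×ˢ (𝓝[>] (0 : ℝ))) (𝓝 x) := by
    have := h1.add ((h2.mono_right nhdsWithin_le_nhds).smul_const d)
    simpa using this
  refine ⟨K * ‖d‖, ?_⟩
  rw [eventually_map]
  filter_upwards [h1 hU, h3 hU, h2 self_mem_nhdsWithin] with q hq1 hq2 hq3
  have hq3 : 0 < q.2 := hq3
  have := hK.dist_le_mul _ hq2 _ hq1
  rw [dist_eq_norm, dist_eq_norm, add_sub_cancel_left, norm_smul, Real.norm_eq_abs,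
    Real.norm_eq_abs, abs_of_pos hq3] at this
  rw [div_le_iff₀ hq3]
  calc _ ≤ _ := le_abs_self _
    _ ≤ _ := this
    _ = _ := by ring

theorem sub_le_clarke {E : Type*} [NormedAddCommGroup E] [NormedSpace ℝ E]
    (f : E → ℝ) (x w u : E) (K : NNReal) (U : Set E) (hU : U ∈ 𝓝 x) (hK : LipschitzOnWith K f U)
    (L M : ℝ) (hL : HasDirDeriv f x w L) (hM : HasDirDeriv f x u M) :
    L - M ≤ clarkeDD f x (w - u) := by
  have hb := clarke_bdd f x (w - u) K U hU hK
  have hid : Tendsto (fun t : ℝ => t) (𝓝[>] (0 : ℝ)) (𝓝 0) := nhdsWithin_le_nhds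
  have hφ : Tendsto (fun t : ℝ => (x + t • u, t)) (𝓝[>] (0 : ℝ)) ((𝓝 x) ×ˢ (𝓝[>] (0 : ℝ))) := by
    refine Tendsto.prodMk ?_ tendsto_id
    simpa using (hid.smul_const u).const_add x
  have ht : Tendsto (fun t : ℝ => (f ((x + t • u) + t • (w - u)) - f (x + t • u)) / t)
      (𝓝[>] (0 : ℝ)) (𝓝 (L - M)) := by
    refine (Tendsto.sub hL hM).congr fun t => ?_
    have : (x + t • u) + t • (w - u) = x + t • w := by rw [smul_sub]; abel
    rw [this]; ring
  refine le_of_forall_lt fun c hc => ?_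
  obtain ⟨c', h1, h2⟩ := exists_between hc
  refine h1.trans_le (le_limsup_of_frequently_le ?_ hb)
  have hev := ht.eventually (lt_mem_nhds h2)
  exact hφ.frequently (p := fun q : E × ℝ => c' ≤ (f (q.1 + q.2 • (w - u)) - f q.1) / q.2)
    (hev.mono fun t h => le_of_lt h).frequently

theorem HasDirDeriv.smul_nonneg {E : Type*} [NormedAddCommGroup E] [NormedSpace ℝ E]
    {f : E → ℝ} {x d : E} {L : ℝ} (h : HasDirDeriv f x d L) {a : ℝ} (ha : 0 ≤ a) :
    HasDirDeriv f x (a • d) (a * L) := by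
  rcases ha.eq_or_lt with rfl | ha
  · simp [HasDirDeriv]
  · have h1 : Tendsto (fun t : ℝ => t * a) (𝓝[>] (0 : ℝ)) (𝓝[>] 0) := by
      refine tendsto_nhdsWithin_iff.2 ⟨?_, ?_⟩
      · have hid : Tendsto (fun t : ℝ => t) (𝓝[>] (0 : ℝ)) (𝓝 0) := nhdsWithin_le_nhds
        simpa using hid.mul_const a
      · filter_upwards [self_mem_nhdsWithin] with t ht
        exact mul_pos ht ha
    refine ((Tendsto.comp h h1).const_mul a).congr fun t => ?_
    simp only [Function.comp, mul_smul]
    field_simp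

theorem DirDiffAt.has {E : Type*} [NormedAddCommGroup E] [NormedSpace ℝ E]
    {f : E → ℝ} {x : E} (h : DirDiffAt f x) (d : E) : HasDirDeriv f x d (dirDeriv f x d) :=
  tendsto_nhds_limUnder (h d)

theorem dirDeriv_odd {E : Type*} [NormedAddCommGroup E] [NormedSpace ℝ E]
    {f : E → ℝ} {x : E} (h : DirDiffAt f x) (d : E) (a : ℝ) :
    dirDeriv f x (a • d) - dirDeriv f x (-(a • d)) =
      a * (dirDeriv f x d - dirDeriv f x (-d)) := by
  have key : ∀ (b : ℝ), 0 ≤ b → ∀ e : E, dirDeriv f x (b • e) = b * dirDeriv f x e :=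
    fun b hb e => tendsto_nhds_unique (h.has (b • e)) ((h.has e).smul_nonneg hb)
  rcases le_total 0 a with ha | ha
  · rw [← smul_neg, key a ha, key a ha]; ring
  · have e1 : a • d = (-a) • (-d) := by simp
    have e2 : -(a • d) = (-a) • d := by simp
    rw [e2, e1, key _ (by linarith), key _ (by linarith)]; ring

/-- change-of-basis version of the compass-difference subgradient result.
If `V` is nonsingular with columns `v₁, v₂`, then
`½·(Vᵀ)⁻¹·(f'(x;v₁) − f'(x;−v₁), f'(x;v₂) − f'(x;−v₂)) ∈ ∂f(x)`. -/
theorem compassDiff_basis_mem_clarkeGrad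
    (X : Set (EuclideanSpace ℝ (Fin 2))) (hX : IsOpen X)
    (f : EuclideanSpace ℝ (Fin 2) → ℝ) (hf : LocLipOn f X)
    (V : Matrix (Fin 2) (Fin 2) ℝ) (hV : V.det ≠ 0)
    (v : Fin 2 → EuclideanSpace ℝ (Fin 2))
    (hv : ∀ i j : Fin 2, v i j = V j i)  -- `v i` is the `i`-th column of `V`
    (x : EuclideanSpace ℝ (Fin 2)) (hx : x ∈ X) (hdd : DirDiffAt f x) :
    (WithLp.equiv 2 (Fin 2 → ℝ)).symm
      ((V.transpose)⁻¹.mulVec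
        (fun i : Fin 2 => (dirDeriv f x (v i) - dirDeriv f x (-(v i))) / 2))
      ∈ clarkeGrad f x := by
  intro d
  obtain ⟨K, U, hU, hK⟩ := hf x hx
  set a : Fin 2 → ℝ := V⁻¹.mulVec (fun i => d i) with ha
  have hVa : V.mulVec a = fun i => d i := by
    rw [ha, Matrix.mulVec_mulVec, Matrix.mul_nonsing_inv _ (isUnit_iff_ne_zero.2 hV),
      Matrix.one_mulVec]
  have hd : d = a 0 • v 0 - (-(a 1 • v 1)) := by
    ext i
    have := congrFun hVa i
    simp only [Matrix.mulVec, dotProduct, Fin.sum_univ_two] at this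
    simp [hv, ← this]
    ring
  have hd' : d = a 1 • v 1 - (-(a 0 • v 0)) := by rw [hd]; abel
  set c : Fin 2 → ℝ := fun i : Fin 2 => (dirDeriv f x (v i) - dirDeriv f x (-(v i))) / 2 with hc
  have hin : ⟪(WithLp.equiv 2 (Fin 2 → ℝ)).symm ((V.transpose)⁻¹.mulVec c), d⟫
      = c 0 * a 0 + c 1 * a 1 := by
    rw [← Matrix.transpose_nonsing_inv]
    simp [ha, PiLp.inner_apply, Matrix.mulVec, dotProduct, Fin.sum_univ_two]
    ring
  rw [hin]
  have k1 := sub_le_clarke f x _ _ K U hU hK _ _ (hdd.has (a 0 • v 0)) (hdd.has (-(a 1 • v 1)))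
  have k2 := sub_le_clarke f x _ _ K U hU hK _ _ (hdd.has (a 1 • v 1)) (hdd.has (-(a 0 • v 0)))
  rw [← hd] at k1
  rw [← hd'] at k2
  have o1 := dirDeriv_odd hdd (v 0) (a 0)
  have o2 := dirDeriv_odd hdd (v 1) (a 1)
  simp only [hc]
  linarith
end
end

section
/- Let X ⊆ ℝ² be open, let f : X → ℝ be locally Lipschitz continuous, and let x ∈ X. Then the vector ½·( f°(x;(1,0)) − f°(x;(−1,0)), f°(x;(0,1)) − f°(x;(0,−1)) ), built from Clarke generalized directional derivatives in the four compass directions, is an element of Clarke's generalized gradient ∂f(x). -/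
open Filter Topology Set
open scoped RealInnerProductSpace

noncomputable section

section helpers
variable {E : Type*} [NormedAddCommGroup E] [NormedSpace ℝ E]

def LipAt (f : E → ℝ) (x : E) : Prop := ∃ K : NNReal, ∃ U ∈ 𝓝 x, LipschitzOnWith K f U

lemma tendsto_shift (x d : E) (c : ℝ) (hc : 0 < c) :
    Tendsto (fun q : E × ℝ => (q.1 + q.2 • d, c * q.2)) ((𝓝 x) ×ˢ (𝓝[>] (0 : ℝ)))
      ((𝓝 x) ×ˢ (𝓝[>] (0 : ℝ))) := by
  have h2 : Tendsto (fun q : E × ℝ => q.2) ((𝓝 x) ×ˢ (𝓝[>] (0 : ℝ))) (𝓝[>] (0 : ℝ)) :=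
    tendsto_snd
  have h2' : Tendsto (fun q : E × ℝ => q.2) ((𝓝 x) ×ˢ (𝓝[>] (0 : ℝ))) (𝓝 (0 : ℝ)) :=
    h2.mono_right nhdsWithin_le_nhds
  have h1 : Tendsto (fun q : E × ℝ => q.1) ((𝓝 x) ×ˢ (𝓝[>] (0 : ℝ))) (𝓝 x) := tendsto_fst
  refine Tendsto.prodMk ?_ ?_
  · simpa using h1.add (h2'.smul_const d)
  · rw [tendsto_nhdsWithin_iff]
    refine ⟨by simpa using h2'.const_mul c, ?_⟩
    filter_upwards [h2.eventually self_mem_nhdsWithin] with q hq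
    exact mul_pos hc hq

lemma ev_pos (x : E) : ∀ᶠ q : E × ℝ in (𝓝 x) ×ˢ (𝓝[>] (0 : ℝ)), 0 < q.2 :=
  (tendsto_snd (f := 𝓝 x) (g := 𝓝[>] (0 : ℝ))).eventually self_mem_nhdsWithin

lemma quot_bdd {f : E → ℝ} {x : E} (hf : LipAt f x) (d : E) :
    ∃ M : ℝ, ∀ᶠ q : E × ℝ in (𝓝 x) ×ˢ (𝓝[>] (0 : ℝ)),
      |(f (q.1 + q.2 • d) - f q.1) / q.2| ≤ M := by
  obtain ⟨K, U, hU, hK⟩ := hf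
  refine ⟨K * ‖d‖, ?_⟩
  have h1 : Tendsto (fun q : E × ℝ => q.1) ((𝓝 x) ×ˢ (𝓝[>] (0 : ℝ))) (𝓝 x) := tendsto_fst
  have h3 : Tendsto (fun q : E × ℝ => q.1 + q.2 • d) ((𝓝 x) ×ˢ (𝓝[>] (0 : ℝ))) (𝓝 x) :=
    tendsto_fst.comp (tendsto_shift x d 1 one_pos)
  filter_upwards [h1.eventually hU, h3.eventually hU, ev_pos x] with q a b hq
  have := hK.dist_le_mul _ b _ a
  rw [Real.dist_eq, dist_eq_norm, add_sub_cancel_left, norm_smul, Real.norm_eq_abs,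
    abs_of_pos hq] at this
  rw [abs_div, abs_of_pos hq, div_le_iff₀ hq]
  linarith

lemma ev_lt {f : E → ℝ} {x : E} (hf : LipAt f x) (d : E) {a : ℝ} (ha : clarkeDD f x d < a) :
    ∀ᶠ q : E × ℝ in (𝓝 x) ×ˢ (𝓝[>] (0 : ℝ)), (f (q.1 + q.2 • d) - f q.1) / q.2 < a := by
  obtain ⟨M, hM⟩ := quot_bdd hf d
  refine eventually_lt_of_limsup_lt ha ?_
  exact ⟨M, eventually_map.2 (hM.mono fun q h => (abs_le.1 h).2)⟩

lemma cdd_le {f : E → ℝ} {x : E} (hf : LipAt f x) (d : E) {a : ℝ}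
    (ha : ∀ᶠ q : E × ℝ in (𝓝 x) ×ˢ (𝓝[>] (0 : ℝ)), (f (q.1 + q.2 • d) - f q.1) / q.2 ≤ a) :
    clarkeDD f x d ≤ a := by
  obtain ⟨M, hM⟩ := quot_bdd hf d
  refine limsup_le_of_le ?_ ha
  refine IsBoundedUnder.isCoboundedUnder_le ?_
  exact ⟨-M, eventually_map.2 (hM.mono fun q h => (abs_le.1 h).1)⟩

lemma cdd_add {f : E → ℝ} {x : E} (hf : LipAt f x) (d e : E) :
    clarkeDD f x (d + e) ≤ clarkeDD f x d + clarkeDD f x e := by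
  refine le_of_forall_pos_le_add fun ε hε => cdd_le hf _ ?_
  have h1 := ev_lt hf d (a := clarkeDD f x d + ε / 2) (by linarith)
  have h2 := (tendsto_shift x d 1 one_pos).eventually
    (ev_lt hf e (a := clarkeDD f x e + ε / 2) (by linarith))
  filter_upwards [h1, h2] with q a b
  simp only [one_mul] at b
  have : (f (q.1 + q.2 • (d + e)) - f q.1) / q.2 =
      (f (q.1 + q.2 • d) - f q.1) / q.2 +
      (f (q.1 + q.2 • d + q.2 • e) - f (q.1 + q.2 • d)) / q.2 := by
    rw [smul_add, ← add_assoc]; ring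
  linarith

lemma cdd_smul_le {f : E → ℝ} {x : E} (hf : LipAt f x) (d : E) {c : ℝ} (hc : 0 < c) :
    clarkeDD f x (c • d) ≤ c * clarkeDD f x d := by
  refine le_of_forall_pos_le_add fun ε hε => cdd_le hf _ ?_
  have h2 := (tendsto_shift x (0 : E) c hc).eventually
    (ev_lt hf d (a := clarkeDD f x d + ε / c) (by linarith [div_pos hε hc]))
  filter_upwards [h2, ev_pos x] with q b hq
  simp only [smul_zero, add_zero] at b
  have : (f (q.1 + q.2 • c • d) - f q.1) / q.2 =
      c * ((f (q.1 + (c * q.2) • d) - f q.1) / (c * q.2)) := by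
    rw [smul_smul, mul_comm q.2 c]; field_simp
  rw [this]
  have h3 := mul_le_mul_of_nonneg_left b.le hc.le
  have h4 : c * (clarkeDD f x d + ε / c) = c * clarkeDD f x d + ε := by field_simp
  linarith

lemma cdd_smul {f : E → ℝ} {x : E} (hf : LipAt f x) (d : E) {c : ℝ} (hc : 0 ≤ c) :
    clarkeDD f x (c • d) = c * clarkeDD f x d := by
  rcases hc.eq_or_lt with rfl | hc
  · simp [clarkeDD]
  · refine le_antisymm (cdd_smul_le hf d hc) ?_
    have := cdd_smul_le hf (c • d) (inv_pos.2 hc)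
    rw [inv_smul_smul₀ hc.ne', ← div_eq_inv_mul, le_div_iff₀ hc] at this
    linarith

lemma key {f : E → ℝ} {x : E} (hf : LipAt f x) (u v : E) {a b : ℝ} (ha : 0 ≤ a) (hb : 0 ≤ b) :
    a * ((clarkeDD f x u - clarkeDD f x (-u)) / 2) +
      b * ((clarkeDD f x v - clarkeDD f x (-v)) / 2) ≤ clarkeDD f x (a • u + b • v) := by
  have h1 := cdd_add hf (a • u + b • v) (b • (-v))
  have h2 := cdd_add hf (a • u + b • v) (a • (-u))
  rw [show a • u + b • v + b • (-v) = a • u by module, cdd_smul hf _ ha, cdd_smul hf _ hb] at h1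
  rw [show a • u + b • v + a • (-u) = b • v by module, cdd_smul hf _ ha, cdd_smul hf _ hb] at h2
  linarith

lemma key' {f : E → ℝ} {x : E} (hf : LipAt f x) (u v : E) (a b : ℝ) :
    a * ((clarkeDD f x u - clarkeDD f x (-u)) / 2) +
      b * ((clarkeDD f x v - clarkeDD f x (-v)) / 2) ≤ clarkeDD f x (a • u + b • v) := by
  rcases le_total 0 a with ha | ha <;> rcases le_total 0 b with hb | hb
  · exact key hf u v ha hb
  · have := key hf u (-v) ha (neg_nonneg.2 hb)
    rw [neg_smul_neg, neg_neg] at this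
    linarith
  · have := key hf (-u) v (neg_nonneg.2 ha) hb
    rw [neg_smul_neg, neg_neg] at this
    linarith
  · have := key hf (-u) (-v) (neg_nonneg.2 ha) (neg_nonneg.2 hb)
    rw [neg_smul_neg, neg_smul_neg, neg_neg, neg_neg] at this
    linarith

end helpers

/-- the compass difference built from Clarke generalized directional
derivatives in the four compass directions is a Clarke subgradient. -/
theorem clarkeDD_compassDiff_mem_clarkeGrad
    (X : Set (EuclideanSpace ℝ (Fin 2))) (hX : IsOpen X)
    (f : EuclideanSpace ℝ (Fin 2) → ℝ) (hf : LocLipOn f X)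
    (x : EuclideanSpace ℝ (Fin 2)) (hx : x ∈ X) :
    (∑ i : Fin 2, ((clarkeDD f x (e2 i) - clarkeDD f x (-(e2 i))) / 2) • e2 i)
      ∈ clarkeGrad f x := by
  intro d
  have hd : d = d 0 • e2 0 + d 1 • e2 1 := by
    ext i; fin_cases i <;> simp [e2]
  have h := key' (hf x hx) (e2 0) (e2 1) (d 0) (d 1)
  rw [← hd] at h
  refine le_trans (le_of_eq ?_) h
  rw [Fin.sum_univ_two, inner_add_left, real_inner_smul_left, real_inner_smul_left]
  simp only [e2, EuclideanSpace.inner_single_left, map_one, one_mul]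
  ring
end
end

section
/- Let X ⊆ ℝ² be open and convex and let f : X → ℝ be convex. Then for each x ∈ X, the compass difference D⋄f(x) is a subgradient of f at x; that is, f(y) ≥ f(x) + ⟨D⋄f(x), y − x⟩ for all y ∈ X. -/
open Filter Topology Set
open scoped RealInnerProductSpace

noncomputable section

theorem aux_exists {E : Type*} [NormedAddCommGroup E] [NormedSpace ℝ E] {X : Set E}
    (hX : IsOpen X) {f : E → ℝ} (hf : ConvexOn ℝ X f) {x : E} (hx : x ∈ X) (d : E) :
    HasDirDeriv f x d (dirDeriv f x d) := by
  have hg : ConvexOn ℝ ((AffineMap.lineMap x (x + d) : ℝ →ᵃ[ℝ] E) ⁻¹' X)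
      (f ∘ (AffineMap.lineMap x (x + d) : ℝ →ᵃ[ℝ] E)) := hf.comp_affineMap _
  have ho : IsOpen ((AffineMap.lineMap x (x + d) : ℝ →ᵃ[ℝ] E) ⁻¹' X) :=
    hX.preimage AffineMap.lineMap_continuous
  have h0 : (0 : ℝ) ∈ interior ((AffineMap.lineMap x (x + d) : ℝ →ᵃ[ℝ] E) ⁻¹' X) := by
    rw [ho.interior_eq]; simpa using hx
  have h1 := hg.hasDerivWithinAt_rightDeriv_of_mem_interior h0
  rw [hasDerivWithinAt_iff_tendsto_slope' (by simp)] at h1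
  refine tendsto_nhds_limUnder ⟨_, h1.congr fun t => ?_⟩
  simp [slope_def_field, AffineMap.lineMap_apply, add_comm]

theorem aux_le {E : Type*} [NormedAddCommGroup E] [NormedSpace ℝ E] {X : Set E}
    {f : E → ℝ} (hf : ConvexOn ℝ X f) {x : E} (hx : x ∈ X) {d : E} (hd : x + d ∈ X) {L : ℝ}
    (h : HasDirDeriv f x d L) : L ≤ f (x + d) - f x := by
  refine le_of_tendsto h ?_
  filter_upwards [Ioo_mem_nhdsGT (zero_lt_one' ℝ)] with t ht
  rw [div_le_iff₀ ht.1]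
  have := hf.2 hx hd (sub_nonneg.2 ht.2.le) ht.1.le (by ring)
  have e : (1 - t) • x + t • (x + d) = x + t • d := by module
  rw [e] at this
  simp only [smul_eq_mul] at this
  linarith

theorem aux_smul {E : Type*} [NormedAddCommGroup E] [NormedSpace ℝ E]
    {f : E → ℝ} {x : E} {d : E} {L : ℝ} (h : HasDirDeriv f x d L) {c : ℝ} (hc : 0 < c) :
    HasDirDeriv f x (c • d) (c * L) := by
  have ht : Tendsto (fun t : ℝ => t * c) (𝓝[>] 0) (𝓝[>] 0) := by
    refine tendsto_nhdsWithin_iff.2 ⟨?_, ?_⟩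
    · have : Tendsto (fun t : ℝ => t * c) (𝓝 0) (𝓝 (0 * c)) := tendsto_id.mul_const c
      rw [zero_mul] at this
      exact this.mono_left nhdsWithin_le_nhds
    · filter_upwards [self_mem_nhdsWithin] with t ht
      exact mul_pos ht hc
  refine ((h.comp ht).const_mul c).congr fun t => ?_
  simp only [Function.comp, smul_smul]
  rw [mul_div_assoc', mul_comm t c, mul_div_mul_left _ _ hc.ne']

theorem aux_add {E : Type*} [NormedAddCommGroup E] [NormedSpace ℝ E] {X : Set E}
    (hX : IsOpen X) {f : E → ℝ} (hf : ConvexOn ℝ X f) {x : E} (hx : x ∈ X) {d d' : E} {L L' M : ℝ}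
    (h : HasDirDeriv f x d L) (h' : HasDirDeriv f x d' L') (hM : HasDirDeriv f x (d + d') M) :
    M ≤ L + L' := by
  have k := aux_smul h two_pos
  have k' := aux_smul h' two_pos
  have hm : ∀ d : E, ∀ᶠ t : ℝ in 𝓝[>] 0, x + t • d ∈ X := fun d => by
    have : Tendsto (fun t : ℝ => x + t • d) (𝓝 0) (𝓝 (x + (0 : ℝ) • d)) :=
      (by fun_prop : Continuous fun t : ℝ => x + t • d).tendsto 0
    rw [zero_smul, add_zero] at this
    exact (this.mono_left nhdsWithin_le_nhds) (hX.mem_nhds hx)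
  have key : M ≤ (1 / 2) * (2 * L + 2 * L') := by
    refine le_of_tendsto_of_tendsto hM ((k.add k').const_mul (1 / 2)) ?_
    filter_upwards [hm ((2 : ℝ) • d), hm ((2 : ℝ) • d'), self_mem_nhdsWithin] with t h1 h2 ht
    have ht' : 0 < t := ht
    have := hf.2 h1 h2 (by norm_num : (0 : ℝ) ≤ 1 / 2) (by norm_num : (0 : ℝ) ≤ 1 / 2) (by norm_num)
    have e : (1 / 2 : ℝ) • (x + t • (2 : ℝ) • d) + (1 / 2 : ℝ) • (x + t • (2 : ℝ) • d')
      = x + t • (d + d') := by module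
    rw [e] at this
    simp only [smul_eq_mul] at this
    rw [← add_div, mul_div_assoc']
    gcongr
    linarith
  linarith

theorem aux_odd {E : Type*} [NormedAddCommGroup E] [NormedSpace ℝ E]
    {f : E → ℝ} {x : E} (H : ∀ d, HasDirDeriv f x d (dirDeriv f x d)) (d : E) (u : ℝ) :
    dirDeriv f x (u • d) - dirDeriv f x (-(u • d)) =
      u * (dirDeriv f x d - dirDeriv f x (-d)) := by
  have hs : ∀ d : E, ∀ c : ℝ, 0 < c → dirDeriv f x (c • d) = c * dirDeriv f x d :=
    fun d c hc => tendsto_nhds_unique (H _) (aux_smul (H d) hc)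
  rcases lt_trichotomy u 0 with hu | rfl | hu
  · have h1 := hs d (-u) (by linarith)
    have h2 := hs (-d) (-u) (by linarith)
    rw [neg_smul_neg] at h2
    rw [neg_smul] at h1
    rw [h1, h2]; ring
  · simp
  · rw [← smul_neg, hs _ _ hu, hs _ _ hu]; ring

/-- for a convex function on an open convex subset of `ℝ²`, the compass
difference is a subgradient: `f(y) ≥ f(x) + ⟨D⋄f(x), y − x⟩` for all `y ∈ X`. -/
theorem compassDiff_is_subgradient_of_convex
    (X : Set (EuclideanSpace ℝ (Fin 2))) (hX : IsOpen X) (hXc : Convex ℝ X)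
    (f : EuclideanSpace ℝ (Fin 2) → ℝ) (hf : ConvexOn ℝ X f)
    (x : EuclideanSpace ℝ (Fin 2)) (hx : x ∈ X) :
    ∀ y ∈ X, f x + ⟪compassDiff f x, y - x⟫ ≤ f y := by
  intro y hy
  have H := fun d => aux_exists hX hf hx d
  have hle : dirDeriv f x (y - x) ≤ f y - f x := by
    have := aux_le hf hx (d := y - x) (by simpa using hy) (H _)
    simpa using this
  set u := (y - x) 0 with hu
  set v := (y - x) 1 with hv
  have hd : y - x = u • e2 0 + v • e2 1 := by
    ext i
    fin_cases i <;> simp [e2, hu, hv]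
  have hin : ⟪compassDiff f x, y - x⟫ =
      (u * (dirDeriv f x (e2 0) - dirDeriv f x (-(e2 0))) +
        v * (dirDeriv f x (e2 1) - dirDeriv f x (-(e2 1)))) / 2 := by
    simp only [compassDiff, Fin.sum_univ_two, inner_add_left, inner_smul_left, e2,
      EuclideanSpace.inner_single_left]
    simp [hu, hv]
    ring
  rw [hin, ← aux_odd H, ← aux_odd H]
  have a1 := aux_add hX hf hx (H (y - x)) (H (-(v • e2 1))) (M := dirDeriv f x (u • e2 0))
    (by have := H (u • e2 0); rwa [hd, add_neg_cancel_right])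
  have a2 := aux_add hX hf hx (H (y - x)) (H (-(u • e2 0))) (M := dirDeriv f x (v • e2 1))
    (by have := H (v • e2 1); rwa [hd, add_comm (u • e2 0), add_neg_cancel_right])
  linarith
end
end

section
/- Let X ⊆ ℝ² be open and convex, let f : X → ℝ be convex, and let V ∈ ℝ^{2×2} be a nonsingular matrix with columns v₁, v₂. Then for each x ∈ X, the vector s := ½·(Vᵀ)⁻¹·( f'(x;v₁) − f'(x;−v₁), f'(x;v₂) − f'(x;−v₂) ) is a subgradient of f at x, i.e. f(y) ≥ f(x) + ⟨s, y − x⟩ for all y ∈ X. -/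
open Filter Topology Set
open scoped RealInnerProductSpace

noncomputable section

lemma eventually_mem_line {X : Set (EuclideanSpace ℝ (Fin 2))} (hX : IsOpen X)
    {x : EuclideanSpace ℝ (Fin 2)} (hx : x ∈ X) (d : EuclideanSpace ℝ (Fin 2)) :
    ∀ᶠ t : ℝ in 𝓝 0, x + t • d ∈ X := by
  have hc : Continuous (fun t : ℝ => x + t • d) := by fun_prop
  exact hc.continuousAt.eventually_mem (by simpa using hX.mem_nhds hx)

lemma hasDirDeriv_dirDeriv {X : Set (EuclideanSpace ℝ (Fin 2))} (hX : IsOpen X)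
    {f : EuclideanSpace ℝ (Fin 2) → ℝ} (hf : ConvexOn ℝ X f)
    {x : EuclideanSpace ℝ (Fin 2)} (hx : x ∈ X) (d : EuclideanSpace ℝ (Fin 2)) :
    HasDirDeriv f x d (dirDeriv f x d) := by
  have h1 := hf.comp_affineMap (AffineMap.lineMap x (x + d) : ℝ →ᵃ[ℝ] EuclideanSpace ℝ (Fin 2))
  have hm : (0 : ℝ) ∈ interior
      ((AffineMap.lineMap x (x + d) : ℝ →ᵃ[ℝ] EuclideanSpace ℝ (Fin 2)) ⁻¹' X) := by
    rw [mem_interior_iff_mem_nhds]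
    filter_upwards [eventually_mem_line hX hx d] with t ht
    simpa [AffineMap.lineMap_apply, add_comm] using ht
  have h2 := h1.hasDerivWithinAt_rightDeriv_of_mem_interior hm
  rw [hasDerivWithinAt_iff_tendsto_slope' self_notMem_Ioi] at h2
  have h3 : ∃ L, HasDirDeriv f x d L := by
    refine ⟨_, h2.congr fun t => ?_⟩
    simp [slope_def_field, AffineMap.lineMap_apply, add_comm]
  exact tendsto_nhds_limUnder h3

lemma dirDeriv_smul_pos {X : Set (EuclideanSpace ℝ (Fin 2))} (hX : IsOpen X)
    {f : EuclideanSpace ℝ (Fin 2) → ℝ} (hf : ConvexOn ℝ X f)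
    {x : EuclideanSpace ℝ (Fin 2)} (hx : x ∈ X) (d : EuclideanSpace ℝ (Fin 2))
    {c : ℝ} (hc : 0 < c) : dirDeriv f x (c • d) = c * dirDeriv f x d := by
  have h1 := hasDirDeriv_dirDeriv hX hf hx (c • d)
  have h2 := hasDirDeriv_dirDeriv hX hf hx d
  unfold HasDirDeriv at h1 h2
  have hl : Tendsto (fun t : ℝ => t * c) (𝓝[>] 0) (𝓝[>] 0) := by
    refine tendsto_nhdsWithin_iff.2 ⟨?_, ?_⟩
    · have : Continuous (fun t : ℝ => t * c) := by fun_prop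
      simpa using (this.tendsto 0).mono_left nhdsWithin_le_nhds
    · filter_upwards [self_mem_nhdsWithin] with t ht
      exact mul_pos ht hc
  refine tendsto_nhds_unique h1 (((h2.comp hl).const_mul c).congr' ?_)
  filter_upwards [self_mem_nhdsWithin] with t ht
  have : t ≠ 0 := ne_of_gt ht
  simp only [Function.comp, smul_smul]
  field_simp

lemma dirDeriv_zero {X : Set (EuclideanSpace ℝ (Fin 2))} (hX : IsOpen X)
    {f : EuclideanSpace ℝ (Fin 2) → ℝ} (hf : ConvexOn ℝ X f)
    {x : EuclideanSpace ℝ (Fin 2)} (hx : x ∈ X) : dirDeriv f x 0 = 0 := by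
  have := dirDeriv_smul_pos hX hf hx 0 (c := 2) (by norm_num)
  rw [smul_zero] at this
  linarith

lemma dirDeriv_add_le {X : Set (EuclideanSpace ℝ (Fin 2))} (hX : IsOpen X)
    {f : EuclideanSpace ℝ (Fin 2) → ℝ} (hf : ConvexOn ℝ X f)
    {x : EuclideanSpace ℝ (Fin 2)} (hx : x ∈ X) (u w : EuclideanSpace ℝ (Fin 2)) :
    dirDeriv f x (u + w) ≤ dirDeriv f x u + dirDeriv f x w := by
  have h0 := hasDirDeriv_dirDeriv hX hf hx (u + w)
  have h1 := hasDirDeriv_dirDeriv hX hf hx ((2 : ℝ) • u)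
  have h2 := hasDirDeriv_dirDeriv hX hf hx ((2 : ℝ) • w)
  have e1 := dirDeriv_smul_pos hX hf hx u (c := 2) (by norm_num)
  have e2 := dirDeriv_smul_pos hX hf hx w (c := 2) (by norm_num)
  have key := le_of_tendsto_of_tendsto h0 ((h1.add h2).const_mul (1 / 2)) (by
    filter_upwards [self_mem_nhdsWithin,
      nhdsWithin_le_nhds (eventually_mem_line hX hx ((2 : ℝ) • u)),
      nhdsWithin_le_nhds (eventually_mem_line hX hx ((2 : ℝ) • w))] with t ht hu hw
    have ht : 0 < t := ht
    have hc := hf.2 hu hw (show (0 : ℝ) ≤ 1 / 2 by norm_num)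
      (show (0 : ℝ) ≤ 1 / 2 by norm_num) (by norm_num)
    have e : (1 / 2 : ℝ) • (x + t • (2 : ℝ) • u) + (1 / 2 : ℝ) • (x + t • (2 : ℝ) • w)
        = x + t • (u + w) := by module
    rw [e, smul_eq_mul, smul_eq_mul] at hc
    rw [← add_div, ← mul_div_assoc]
    gcongr
    linarith)
  linarith

lemma dirDeriv_le_sub {X : Set (EuclideanSpace ℝ (Fin 2))} (hX : IsOpen X)
    {f : EuclideanSpace ℝ (Fin 2) → ℝ} (hf : ConvexOn ℝ X f)
    {x : EuclideanSpace ℝ (Fin 2)} (hx : x ∈ X) {y : EuclideanSpace ℝ (Fin 2)} (hy : y ∈ X) :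
    dirDeriv f x (y - x) ≤ f y - f x := by
  refine le_of_tendsto (hasDirDeriv_dirDeriv hX hf hx (y - x)) ?_
  filter_upwards [self_mem_nhdsWithin,
    nhdsWithin_le_nhds (eventually_lt_nhds (zero_lt_one (α := ℝ)))] with t ht ht1
  have ht : 0 < t := ht
  have hc := hf.2 hx hy (show (0 : ℝ) ≤ 1 - t by linarith) ht.le (by ring)
  have e : (1 - t) • x + t • y = x + t • (y - x) := by module
  rw [e, smul_eq_mul, smul_eq_mul] at hc
  rw [div_le_iff₀ ht]
  linarith

/-- The central difference of directional derivatives is homogeneous. -/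
lemma dirDeriv_central_smul {X : Set (EuclideanSpace ℝ (Fin 2))} (hX : IsOpen X)
    {f : EuclideanSpace ℝ (Fin 2) → ℝ} (hf : ConvexOn ℝ X f)
    {x : EuclideanSpace ℝ (Fin 2)} (hx : x ∈ X) (d : EuclideanSpace ℝ (Fin 2)) (c : ℝ) :
    dirDeriv f x (c • d) - dirDeriv f x (-(c • d))
      = c * (dirDeriv f x d - dirDeriv f x (-d)) := by
  rcases lt_trichotomy c 0 with hc | rfl | hc
  · have e1 : c • d = (-c) • (-d) := by module
    have e2 : -(c • d) = (-c) • d := by module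
    rw [e2, e1, dirDeriv_smul_pos hX hf hx _ (neg_pos.2 hc),
      dirDeriv_smul_pos hX hf hx _ (neg_pos.2 hc)]
    ring
  · simp
  · rw [← smul_neg, dirDeriv_smul_pos hX hf hx _ hc, dirDeriv_smul_pos hX hf hx _ hc]
    ring

/-- change-of-basis version for convex functions.  If `V` is nonsingular
with columns `v₁, v₂`, then `s := ½·(Vᵀ)⁻¹·(f'(x;v₁) − f'(x;−v₁), f'(x;v₂) − f'(x;−v₂))`
is a subgradient of the convex function `f` at `x`. -/
theorem compassDiff_basis_is_subgradient_of_convex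
    (X : Set (EuclideanSpace ℝ (Fin 2))) (hX : IsOpen X) (hXc : Convex ℝ X)
    (f : EuclideanSpace ℝ (Fin 2) → ℝ) (hf : ConvexOn ℝ X f)
    (V : Matrix (Fin 2) (Fin 2) ℝ) (hV : V.det ≠ 0)
    (v : Fin 2 → EuclideanSpace ℝ (Fin 2))
    (hv : ∀ i j : Fin 2, v i j = V j i)  -- `v i` is the `i`-th column of `V`
    (x : EuclideanSpace ℝ (Fin 2)) (hx : x ∈ X)
    (s : EuclideanSpace ℝ (Fin 2))
    (hs : s = (WithLp.equiv 2 (Fin 2 → ℝ)).symm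
      ((V.transpose)⁻¹.mulVec
        (fun i : Fin 2 => (dirDeriv f x (v i) - dirDeriv f x (-(v i))) / 2))) :
    ∀ y ∈ X, f x + ⟪s, y - x⟫ ≤ f y := by
  intro y hy
  have hq : V.transpose.mulVec s.ofLp =
      (fun i : Fin 2 => (dirDeriv f x (v i) - dirDeriv f x (-(v i))) / 2) := by
    rw [hs]
    simp only [WithLp.equiv_symm_apply]
    rw [Matrix.mulVec_mulVec, Matrix.mul_nonsing_inv _ (by simpa using hV), Matrix.one_mulVec]
  have q0 := congrFun hq 0
  have q1 := congrFun hq 1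
  simp only [Matrix.mulVec, dotProduct, Fin.sum_univ_two, Matrix.transpose_apply] at q0 q1
  have hdet := hV
  rw [Matrix.det_fin_two] at hdet
  obtain ⟨a, b, hab⟩ : ∃ a b : ℝ, y - x = a • v 0 + b • v 1 := by
    refine ⟨(V 1 1 * (y - x) 0 - V 0 1 * (y - x) 1) / (V 0 0 * V 1 1 - V 0 1 * V 1 0),
      (V 0 0 * (y - x) 1 - V 1 0 * (y - x) 0) / (V 0 0 * V 1 1 - V 0 1 * V 1 0), ?_⟩
    ext i
    fin_cases i
    · simp only [PiLp.add_apply, PiLp.smul_apply, smul_eq_mul, hv, Fin.zero_eta]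
      rw [div_mul_eq_mul_div, div_mul_eq_mul_div, ← add_div, eq_div_iff hdet]
      ring
    · simp only [PiLp.add_apply, PiLp.smul_apply, smul_eq_mul, hv, Fin.mk_one]
      rw [div_mul_eq_mul_div, div_mul_eq_mul_div, ← add_div, eq_div_iff hdet]
      ring
  have hin : ⟪s, y - x⟫ = a * ((dirDeriv f x (v 0) - dirDeriv f x (-(v 0))) / 2)
      + b * ((dirDeriv f x (v 1) - dirDeriv f x (-(v 1))) / 2) := by
    rw [hab, ← q0, ← q1]
    simp only [PiLp.inner_apply, Fin.sum_univ_two, PiLp.add_apply, PiLp.smul_apply, smul_eq_mul,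
      hv, RCLike.inner_apply, conj_trivial]
    ring
  have c0 := dirDeriv_central_smul hX hf hx (v 0) a
  have c1 := dirDeriv_central_smul hX hf hx (v 1) b
  have s0 := dirDeriv_add_le hX hf hx (y - x) (-(b • v 1))
  have s1 := dirDeriv_add_le hX hf hx (y - x) (-(a • v 0))
  have r0 : y - x + -(b • v 1) = a • v 0 := by rw [hab]; abel
  have r1 : y - x + -(a • v 0) = b • v 1 := by rw [hab]; abel
  rw [r0] at s0
  rw [r1] at s1
  have hle := dirDeriv_le_sub hX hf hx hy
  linarith
end
end

section
/- Every nonempty compact convex set C ⊆ ℝ² contains the midpoint of its interval hull; equivalently, the point z ∈ ℝ² with coordinates z₁ = ½·( sup{x₁ : x ∈ C} + inf{x₁ : x ∈ C} ) and z₂ = ½·( sup{x₂ : x ∈ C} + inf{x₂ : x ∈ C} ) satisfies z ∈ C. -/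
open Set

noncomputable section

/-- every nonempty compact convex set `C ⊆ ℝ²` contains the midpoint of
its interval hull, i.e. the point whose `i`-th coordinate is
`½·(sup{xᵢ : x ∈ C} + inf{xᵢ : x ∈ C})`. -/
theorem midpoint_intervalHull_mem
    (C : Set (EuclideanSpace ℝ (Fin 2)))
    (hne : C.Nonempty) (hcomp : IsCompact C) (hconv : Convex ℝ C)
    (z : EuclideanSpace ℝ (Fin 2))
    (hz : ∀ i : Fin 2,
      z i = (sSup ((fun x : EuclideanSpace ℝ (Fin 2) => x i) '' C)
             + sInf ((fun x : EuclideanSpace ℝ (Fin 2) => x i) '' C)) / 2) :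
    z ∈ C := by
  have key : ∀ i : Fin 2, ∃ r : ℝ, (∀ x ∈ C, |x i - z i| ≤ r) ∧
      (∃ x ∈ C, x i - z i = r) ∧ (∃ x ∈ C, x i - z i = -r) := by
    intro i
    have hc : IsCompact ((fun x : EuclideanSpace ℝ (Fin 2) => x i) '' C) :=
      hcomp.image (by fun_prop)
    have hn := hne.image (fun x : EuclideanSpace ℝ (Fin 2) => x i)
    obtain ⟨a, ha, ha'⟩ := hc.sSup_mem hn
    obtain ⟨b, hb, hb'⟩ := hc.sInf_mem hn
    have hzi := hz i
    dsimp only at ha' hb'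
    rw [← ha', ← hb'] at hzi
    refine ⟨(a i - b i) / 2, ?_, ⟨a, ha, by linarith⟩, ⟨b, hb, by linarith⟩⟩
    intro x hx
    have h1 := le_csSup hc.bddAbove (mem_image_of_mem (fun x : EuclideanSpace ℝ (Fin 2) => x i) hx)
    have h2 := csInf_le hc.bddBelow (mem_image_of_mem (fun x : EuclideanSpace ℝ (Fin 2) => x i) hx)
    dsimp only at h1 h2
    rw [← ha'] at h1
    rw [← hb'] at h2
    rw [abs_le]
    constructor <;> linarith
  by_contra hzC
  obtain ⟨f, u, hfz, hfu⟩ := geometric_hahn_banach_point_closed hconv hcomp.isClosed hzC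
  obtain ⟨p, q, hf⟩ : ∃ p q : ℝ, ∀ x : EuclideanSpace ℝ (Fin 2), f x = p * x 0 + q * x 1 := by
    refine ⟨f (EuclideanSpace.single 0 1), f (EuclideanSpace.single 1 1), fun x => ?_⟩
    have hx : x = x 0 • EuclideanSpace.single (0 : Fin 2) (1 : ℝ)
        + x 1 • EuclideanSpace.single (1 : Fin 2) (1 : ℝ) := by
      ext i
      fin_cases i <;> simp
    conv_lhs => rw [hx]
    rw [map_add, map_smul, map_smul, smul_eq_mul, smul_eq_mul]
    ring
  have hpos : ∀ x ∈ C, 0 < p * (x 0 - z 0) + q * (x 1 - z 1) := by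
    intro x hx
    have h := hfu x hx
    rw [hf] at h hfz
    linarith
  have ext : ∀ (i : Fin 2) (r c : ℝ), (∃ x ∈ C, x i - z i = r) → (∃ x ∈ C, x i - z i = -r) →
      ∃ x ∈ C, c * (x i - z i) = -(|c| * r) := by
    rintro i r c ⟨x, hx, h⟩ ⟨y, hy, h'⟩
    rcases le_total 0 c with hc | hc
    · exact ⟨y, hy, by rw [h', abs_of_nonneg hc]; ring⟩
    · exact ⟨x, hx, by rw [h, abs_of_nonpos hc]; ring⟩
  have bd : ∀ c t r : ℝ, |t| ≤ r → c * t ≤ |c| * r := fun c t r h =>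
    (le_abs_self _).trans (by rw [abs_mul]; gcongr)
  obtain ⟨a, ha, ha1, ha2⟩ := key 0
  obtain ⟨b, hb, hb1, hb2⟩ := key 1
  obtain ⟨x, hx, hxe⟩ := ext 0 a p ha1 ha2
  obtain ⟨y, hy, hye⟩ := ext 1 b q hb1 hb2
  have h1 := hpos x hx
  have h2 := hpos y hy
  have h3 := bd q _ _ (hb x hx)
  have h4 := bd p _ _ (ha y hy)
  linarith
end
end

section
/- Let ψ : ℝⁿ → ℝ be positively homogeneous and locally Lipschitz continuous. Then for any x, y ∈ ℝⁿ there exists s ∈ ∂ψ(0) (Clarke's generalized gradient of ψ at 0) such that ψ(y) − ψ(x) = ⟨s, y − x⟩. -/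
open Filter Topology Set
open scoped RealInnerProductSpace

noncomputable section

/-- A positively homogeneous, locally Lipschitz function is globally Lipschitz. -/
theorem posHom_global_lipschitz {E : Type*} [NormedAddCommGroup E] [NormedSpace ℝ E]
    (ψ : E → ℝ) (hpos : ∀ t : ℝ, 0 ≤ t → ∀ x : E, ψ (t • x) = t * ψ x)
    (hlip : LocallyLipschitz ψ) :
    ∃ K : ℝ, ∀ u v : E, ψ u - ψ v ≤ K * ‖u - v‖ := by
  obtain ⟨K, t, ht, hK⟩ := hlip 0
  refine ⟨K, fun u v => ?_⟩
  have key : ∀ w : E, ∀ᶠ c : ℝ in 𝓝[>] 0, c • w ∈ t := by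
    intro w
    have h1 : Tendsto (fun c : ℝ => c • w) (𝓝 0) (𝓝 0) := by
      have : Continuous (fun c : ℝ => c • w) := by fun_prop
      simpa using this.tendsto 0
    exact (h1.mono_left nhdsWithin_le_nhds).eventually ht
  have h0 : ∀ᶠ c : ℝ in 𝓝[>] 0, 0 < c := self_mem_nhdsWithin
  obtain ⟨c, hu, hv, hc⟩ := ((key u).and ((key v).and h0)).exists
  have h2 := hK.dist_le_mul _ hu _ hv
  rw [Real.dist_eq, dist_eq_norm, hpos c hc.le, hpos c hc.le, ← smul_sub, norm_smul,
    Real.norm_eq_abs, abs_of_pos hc] at h2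
  have h3 := (le_abs_self _).trans h2
  have h4 : c * (ψ u - ψ v) ≤ c * (K * ‖u - v‖) := by linarith
  exact le_of_mul_le_mul_left h4 hc

theorem posHom_le_clarkeDD {E : Type*} [NormedAddCommGroup E] [NormedSpace ℝ E]
    (ψ : E → ℝ) (hpos : ∀ t : ℝ, 0 ≤ t → ∀ x : E, ψ (t • x) = t * ψ x)
    (K : ℝ) (hK : ∀ u v : E, ψ u - ψ v ≤ K * ‖u - v‖) (z v : E) :
    ψ (z + v) - ψ z ≤ clarkeDD ψ 0 v := by
  have h0 : ∀ᶠ c : ℝ in 𝓝[>] 0, 0 < c := self_mem_nhdsWithin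
  unfold clarkeDD
  apply le_limsup_of_frequently_le
  · have h1 : Tendsto (fun c : ℝ => (c • z, c)) (𝓝[>] 0) (𝓝 (0 : E) ×ˢ 𝓝[>] (0 : ℝ)) := by
      refine Tendsto.prodMk ?_ tendsto_id
      have : Continuous (fun c : ℝ => c • z) := by fun_prop
      have h2 := this.tendsto 0
      rw [zero_smul] at h2
      exact h2.mono_left nhdsWithin_le_nhds
    refine h1.frequently (Eventually.frequently ?_)
    filter_upwards [h0] with c hc
    rw [← smul_add, hpos c hc.le, hpos c hc.le, ← mul_sub, mul_div_cancel_left₀ _ hc.ne']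
  · refine isBoundedUnder_of_eventually_le (a := K * ‖v‖) ?_
    have h2 : ∀ᶠ q : E × ℝ in 𝓝 (0 : E) ×ˢ 𝓝[>] (0 : ℝ), 0 < q.2 := tendsto_snd.eventually h0
    filter_upwards [h2] with q hq
    rw [div_le_iff₀ hq]
    have h3 := hK (q.1 + q.2 • v) q.1
    rw [add_sub_cancel_left, norm_smul, Real.norm_eq_abs, abs_of_pos hq] at h3
    linarith

/-- mean-value theorem for positively homogeneous locally Lipschitz
functions: for any `x, y` there is `s ∈ ∂ψ(0)` with `ψ(y) − ψ(x) = ⟨s, y − x⟩`. -/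
theorem meanValue_posHomogeneous
    (n : ℕ) (ψ : EuclideanSpace ℝ (Fin n) → ℝ)
    (hpos : ∀ t : ℝ, 0 ≤ t → ∀ x : EuclideanSpace ℝ (Fin n), ψ (t • x) = t * ψ x)
    (hlip : LocallyLipschitz ψ) :
    ∀ x y : EuclideanSpace ℝ (Fin n),
      ∃ s ∈ clarkeGrad ψ 0, ψ y - ψ x = ⟪s, y - x⟫ := by
  intro x y
  obtain ⟨K, hK⟩ := posHom_global_lipschitz ψ hpos hlip
  set p : EuclideanSpace ℝ (Fin n) → ℝ := fun v => ⨆ z, (ψ (z + v) - ψ z) with hp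
  have hbdd : ∀ v, BddAbove (range fun z => ψ (z + v) - ψ z) := by
    intro v
    refine ⟨K * ‖v‖, ?_⟩
    rintro _ ⟨z, rfl⟩
    simpa using hK (z + v) z
  have hle : ∀ z v, ψ (z + v) - ψ z ≤ p v := fun z v => le_ciSup (hbdd v) z
  have hadd : ∀ u v, p (u + v) ≤ p u + p v := by
    intro u v
    refine ciSup_le fun z => ?_
    have h1 := hle z u
    have h2 := hle (z + u) v
    rw [← add_assoc]
    linarith
  have hsm1 : ∀ c : ℝ, 0 < c → ∀ v, c * p v ≤ p (c • v) := by
    intro c hc v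
    rw [← le_div_iff₀' hc]
    refine ciSup_le fun z => ?_
    rw [le_div_iff₀' hc]
    have h := hle (c • z) (c • v)
    rw [← smul_add, hpos c hc.le, hpos c hc.le] at h
    linarith
  have hsm : ∀ c : ℝ, 0 < c → ∀ v, p (c • v) = c * p v := by
    intro c hc v
    refine le_antisymm ?_ (hsm1 c hc v)
    have h := hsm1 c⁻¹ (inv_pos.mpr hc) (c • v)
    rw [smul_smul, inv_mul_cancel₀ hc.ne', one_smul, inv_mul_le_iff₀ hc] at h
    exact h
  have hp0 : 0 ≤ p 0 := by simpa using hle 0 0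
  set a : ℝ := ψ y - ψ x with ha
  have h1 : a ≤ p (y - x) := by simpa [ha] using hle x (y - x)
  have h2 : -a ≤ p (-(y - x)) := by simpa [ha] using hle y (-(y - x))
  have H : ∀ c : ℝ, c • (y - x) = 0 → c • a = 0 := by
    intro c hc
    rcases smul_eq_zero.mp hc with h | h
    · simp [h]
    · have : y = x := sub_eq_zero.mp h
      simp [ha, this]
  let f : EuclideanSpace ℝ (Fin n) →ₗ.[ℝ] ℝ := LinearPMap.mkSpanSingleton' (y - x) a H
  obtain ⟨g, hg1, hg2⟩ := exists_extension_of_le_sublinear f p hsm hadd (by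
      rintro ⟨w, hw⟩
      obtain ⟨c, rfl⟩ := Submodule.mem_span_singleton.mp hw
      rw [LinearPMap.mkSpanSingleton'_apply]
      simp only [smul_eq_mul, RingHom.id_apply]
      rcases lt_trichotomy c 0 with hc | hc | hc
      · have h3 := hsm (-c) (by linarith) (-(y - x))
        rw [smul_neg, neg_smul, neg_neg] at h3
        rw [h3]
        nlinarith
      · subst hc
        simpa using hp0
      · rw [hsm c hc]
        exact mul_le_mul_of_nonneg_left h1 hc.le)
  refine ⟨(InnerProductSpace.toDual ℝ _).symm (LinearMap.toContinuousLinearMap g), ?_, ?_⟩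
  · intro d
    rw [InnerProductSpace.toDual_symm_apply]
    exact (hg2 d).trans (ciSup_le fun z => posHom_le_clarkeDD ψ hpos K hK z d)
  · rw [InnerProductSpace.toDual_symm_apply]
    have hmem : y - x ∈ f.domain :=
      Submodule.mem_span_singleton_self _
    have h3 := hg1 ⟨y - x, hmem⟩
    rw [LinearPMap.mkSpanSingleton'_apply_self] at h3
    exact h3.symm
end
end

section
/- Let ψ : ℝ² → ℝ be positively homogeneous and Lipschitz continuous, and suppose ψ(1,0) = ψ(−1,0) and ψ(0,1) = ψ(0,−1). Then 0 ∈ ∂ψ(0), i.e. the Clarke generalized directional derivative satisfies ψ°(0;d) ≥ 0 for every d ∈ ℝ². -/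
open Filter Topology Set
open scoped RealInnerProductSpace

noncomputable section

/-- if `ψ : ℝ² → ℝ` is positively homogeneous, Lipschitz, and satisfies
`ψ(1,0) = ψ(−1,0)` and `ψ(0,1) = ψ(0,−1)`, then `0 ∈ ∂ψ(0)`, i.e. `ψ°(0;d) ≥ 0`
for every direction `d`. -/
theorem zero_mem_clarkeGrad_of_compass_symm
    (ψ : EuclideanSpace ℝ (Fin 2) → ℝ)
    (hpos : ∀ t : ℝ, 0 ≤ t → ∀ x : EuclideanSpace ℝ (Fin 2), ψ (t • x) = t * ψ x)
    (hlip : ∃ K : NNReal, LipschitzWith K ψ)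
    (h1 : ψ (e2 0) = ψ (-(e2 0)))
    (h2 : ψ (e2 1) = ψ (-(e2 1))) :
    (0 : EuclideanSpace ℝ (Fin 2)) ∈ clarkeGrad ψ 0 ∧
      ∀ d : EuclideanSpace ℝ (Fin 2), 0 ≤ clarkeDD ψ 0 d := by
  obtain ⟨K, hK⟩ := hlip
  have key : ∀ d : EuclideanSpace ℝ (Fin 2), 0 ≤ clarkeDD ψ 0 d := by
    intro d
    have even : ∀ i : Fin 2, ψ (e2 i) = ψ (-(e2 i)) → ∀ r : ℝ,
        ψ (r • e2 i) = ψ ((-r) • e2 i) := by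
      intro i hi r
      rcases le_total 0 r with hr | hr
      · rw [hpos r hr, neg_smul, ← smul_neg, hpos r hr, hi]
      · have h3 : r • e2 i = (-r) • (-(e2 i)) := by simp
        rw [h3, hpos (-r) (by linarith), hpos (-r) (by linarith), hi]
    have hd : d = d 0 • e2 0 + d 1 • e2 1 := by
      ext i
      fin_cases i <;> simp [e2]
    have hex : ∃ y : EuclideanSpace ℝ (Fin 2), 0 ≤ ψ (y + d) - ψ y := by
      have ea := even 0 h1 (d 0)
      have eb := even 1 h2 (d 1)
      have y1 : (-(d 0)) • e2 0 + d = d 1 • e2 1 := by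
        nth_rw 2 [hd]
        module
      have y2 : (-(d 1)) • e2 1 + d = d 0 • e2 0 := by
        nth_rw 2 [hd]
        module
      rcases le_total (ψ (d 0 • e2 0)) (ψ (d 1 • e2 1)) with h | h
      · exact ⟨(-(d 0)) • e2 0, by rw [y1]; linarith⟩
      · exact ⟨(-(d 1)) • e2 1, by rw [y2]; linarith⟩
    obtain ⟨y, hy⟩ := hex
    unfold clarkeDD
    apply le_limsup_of_frequently_le
    · have ht : Tendsto (fun s : ℝ => (s • y, s)) (𝓝[>] (0 : ℝ))
          ((𝓝 (0 : EuclideanSpace ℝ (Fin 2))) ×ˢ (𝓝[>] (0 : ℝ))) := by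
        apply Tendsto.prodMk _ tendsto_id
        have hc : Continuous (fun s : ℝ => s • y) := by fun_prop
        have := hc.tendsto 0
        rw [zero_smul] at this
        exact this.mono_left nhdsWithin_le_nhds
      apply ht.frequently
      apply Eventually.frequently
      filter_upwards [self_mem_nhdsWithin] with s hs
      have hs' : (0 : ℝ) < s := hs
      rw [← smul_add, hpos s hs'.le, hpos s hs'.le, ← mul_sub]
      positivity
    · refine isBoundedUnder_of_eventually_le (a := K * ‖d‖) ?_
      have hp : ∀ᶠ q : EuclideanSpace ℝ (Fin 2) × ℝ in
          (𝓝 (0 : EuclideanSpace ℝ (Fin 2))) ×ˢ (𝓝[>] (0 : ℝ)), 0 < q.2 :=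
        tendsto_snd.eventually (self_mem_nhdsWithin : Ioi (0 : ℝ) ∈ 𝓝[>] (0 : ℝ))
      filter_upwards [hp] with q hq
      rw [div_le_iff₀ hq]
      have := hK.dist_le_mul (q.1 + q.2 • d) q.1
      rw [Real.dist_eq, dist_eq_norm, add_sub_cancel_left, norm_smul, Real.norm_eq_abs,
        abs_of_pos hq] at this
      have h4 := le_abs_self (ψ (q.1 + q.2 • d) - ψ q.1)
      linarith
  refine ⟨?_, key⟩
  intro d
  rw [inner_zero_left]
  exact key d
end
end

section
/- Let ψ : ℝ² → ℝ be convex and positively homogeneous, and suppose ψ(1,0) = ψ(−1,0) and ψ(0,1) = ψ(0,−1). Then ψ(d) ≥ 0 for every d ∈ ℝ². -/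
open Set

noncomputable section

/-- if `ψ : ℝ² → ℝ` is convex and positively homogeneous with
`ψ(1,0) = ψ(−1,0)` and `ψ(0,1) = ψ(0,−1)`, then `ψ(d) ≥ 0` for every `d`. -/
theorem convex_posHomog_compass_symm_nonneg
    (ψ : EuclideanSpace ℝ (Fin 2) → ℝ)
    (hconv : ConvexOn ℝ univ ψ)
    (hpos : ∀ t : ℝ, 0 ≤ t → ∀ x : EuclideanSpace ℝ (Fin 2), ψ (t • x) = t * ψ x)
    (h1 : ψ (e2 0) = ψ (-(e2 0)))
    (h2 : ψ (e2 1) = ψ (-(e2 1))) :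
    ∀ d : EuclideanSpace ℝ (Fin 2), 0 ≤ ψ d := by
  have hsub : ∀ x y, ψ (x + y) ≤ ψ x + ψ y := by
    intro x y
    have h := hconv.2 (mem_univ x) (mem_univ y) (by norm_num : (0:ℝ) ≤ 1/2)
      (by norm_num : (0:ℝ) ≤ 1/2) (by norm_num)
    rw [← smul_add, hpos _ (by norm_num)] at h
    simp only [smul_eq_mul] at h
    linarith
  have habs : ∀ e, ψ e = ψ (-e) → ∀ t : ℝ, ψ (t • e) = |t| * ψ e := by
    intro e he t
    rcases le_total 0 t with ht | ht
    · rw [abs_of_nonneg ht, hpos t ht]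
    · rw [abs_of_nonpos ht, he, ← hpos (-t) (by linarith), smul_neg, neg_smul, neg_neg]
  intro d
  have hd : d = d 0 • e2 0 + d 1 • e2 1 := by
    ext i
    fin_cases i <;> simp [e2]
  have a0 := habs _ h1 (d 0)
  have a1 := habs _ h2 (d 1)
  have b0 := habs _ h1 (-d 0)
  have b1 := habs _ h2 (-d 1)
  rw [abs_neg] at b0 b1
  have c0 := hsub d (-d 1 • e2 1)
  have c1 := hsub d (-d 0 • e2 0)
  have k0 : d + -d 1 • e2 1 = d 0 • e2 0 := by
    nth_rewrite 1 [hd]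
    module
  have k1 : d + -d 0 • e2 0 = d 1 • e2 1 := by
    nth_rewrite 1 [hd]
    module
  rw [k0] at c0
  rw [k1] at c1
  linarith
end
end

section
/- Define C₁ := conv{(1,1,−1), (−1,1,1), (1,−1,1), (1,1,1)} ⊆ ℝ³ and C₂ := conv{(1,−1,−1), (−1,1,−1), (−1,−1,1), (−1,−1,−1)} ⊆ ℝ³. Then C₁ and C₂ are nonempty, compact, and convex; C₁ ∩ C₂ = ∅ (indeed ⟨(1,1,1), x⟩ ≥ 1 for all x ∈ C₁ while ⟨(1,1,1), y⟩ ≤ −1 for all y ∈ C₂); both C₁ and C₂ have interval hull [−1,1]³; and the midpoint (0,0,0) of this interval hull belongs to neither C₁ nor C₂. Hence in ℝ³ a nonempty compact convex set need not contain the midpoint of its interval hull. -/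
open Set
open scoped RealInnerProductSpace

noncomputable section

/-- The point `(a, b, c) ∈ ℝ³`. -/
def pt (a b c : ℝ) : EuclideanSpace ℝ (Fin 3) :=
  (WithLp.equiv 2 (Fin 3 → ℝ)).symm ![a, b, c]

/-- `C₁ := conv{(1,1,−1), (−1,1,1), (1,−1,1), (1,1,1)}`. -/
def C1 : Set (EuclideanSpace ℝ (Fin 3)) :=
  convexHull ℝ {pt 1 1 (-1), pt (-1) 1 1, pt 1 (-1) 1, pt 1 1 1}

/-- `C₂ := conv{(1,−1,−1), (−1,1,−1), (−1,−1,1), (−1,−1,−1)}`. -/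
def C2 : Set (EuclideanSpace ℝ (Fin 3)) :=
  convexHull ℝ {pt 1 (-1) (-1), pt (-1) 1 (-1), pt (-1) (-1) 1, pt (-1) (-1) (-1)}

/-- A set is an interval in `ℝ³` if it has the form `{x : a ≤ x ≤ b}` componentwise. -/
def IsInterval3 (S : Set (EuclideanSpace ℝ (Fin 3))) : Prop :=
  ∃ a b : EuclideanSpace ℝ (Fin 3), S = {x | ∀ i : Fin 3, a i ≤ x i ∧ x i ≤ b i}

/-- The interval hull of a set: the intersection of all interval supersets. -/
def intervalHull3 (B : Set (EuclideanSpace ℝ (Fin 3))) : Set (EuclideanSpace ℝ (Fin 3)) :=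
  ⋂₀ {S | IsInterval3 S ∧ B ⊆ S}

theorem inner_pt_one (x : EuclideanSpace ℝ (Fin 3)) : ⟪pt 1 1 1, x⟫ = x 0 + x 1 + x 2 := by
  simp [pt, PiLp.inner_apply, Fin.sum_univ_three]

theorem pt2 (a b c : ℝ) : (pt a b c) 2 = c := rfl

theorem convex_inner_ge : Convex ℝ {x : EuclideanSpace ℝ (Fin 3) | 1 ≤ ⟪pt 1 1 1, x⟫} :=
  convex_halfSpace_ge (innerSL ℝ (pt 1 1 1)).toLinearMap.isLinear 1

theorem convex_inner_le : Convex ℝ {x : EuclideanSpace ℝ (Fin 3) | ⟪pt 1 1 1, x⟫ ≤ -1} :=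
  convex_halfSpace_le (innerSL ℝ (pt 1 1 1)).toLinearMap.isLinear (-1)

theorem convex_box : Convex ℝ {x : EuclideanSpace ℝ (Fin 3) | ∀ i, -1 ≤ x i ∧ x i ≤ 1} := by
  intro x hx y hy a b ha hb hab i
  have h1 := hx i
  have h2 := hy i
  simp only [PiLp.add_apply, PiLp.smul_apply, smul_eq_mul]
  constructor <;> nlinarith

theorem C1_inner : ∀ x ∈ C1, 1 ≤ ⟪pt 1 1 1, x⟫ := by
  intro x hx
  refine convexHull_min ?_ convex_inner_ge hx
  rintro y (rfl | rfl | rfl | rfl) <;> simp only [mem_ofPred_eq, inner_pt_one, pt2] <;> norm_num [pt]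

theorem C2_inner : ∀ x ∈ C2, ⟪pt 1 1 1, x⟫ ≤ -1 := by
  intro x hx
  refine convexHull_min ?_ convex_inner_le hx
  rintro y (rfl | rfl | rfl | rfl) <;> simp only [mem_ofPred_eq, inner_pt_one, pt2] <;> norm_num [pt]

theorem C1_box : C1 ⊆ {x : EuclideanSpace ℝ (Fin 3) | ∀ i, -1 ≤ x i ∧ x i ≤ 1} := by
  refine convexHull_min ?_ convex_box
  rintro y (rfl | rfl | rfl | rfl) i <;> fin_cases i <;> norm_num [pt]

theorem C2_box : C2 ⊆ {x : EuclideanSpace ℝ (Fin 3) | ∀ i, -1 ≤ x i ∧ x i ≤ 1} := by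
  refine convexHull_min ?_ convex_box
  rintro y (rfl | rfl | rfl | rfl) i <;> fin_cases i <;> norm_num [pt]

theorem isInterval3_box :
    IsInterval3 {x : EuclideanSpace ℝ (Fin 3) | ∀ i, -1 ≤ x i ∧ x i ≤ 1} := by
  refine ⟨pt (-1) (-1) (-1), pt 1 1 1, ?_⟩
  ext x
  simp [pt, Fin.forall_fin_succ]

/-- A subset of the cube touching all its facets has the cube as interval hull. -/
theorem hull_eq (B : Set (EuclideanSpace ℝ (Fin 3)))
    (hB : B ⊆ {x : EuclideanSpace ℝ (Fin 3) | ∀ i, -1 ≤ x i ∧ x i ≤ 1})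
    (hlo : ∀ i, ∃ x ∈ B, x i = -1) (hhi : ∀ i, ∃ x ∈ B, x i = 1) :
    intervalHull3 B = {x : EuclideanSpace ℝ (Fin 3) | ∀ i, -1 ≤ x i ∧ x i ≤ 1} := by
  apply Subset.antisymm
  · exact sInter_subset_of_mem ⟨isInterval3_box, hB⟩
  · rintro x hx S ⟨⟨a, b, rfl⟩, hS⟩ i
    obtain ⟨y, hy, hyi⟩ := hlo i
    obtain ⟨z, hz, hzi⟩ := hhi i
    have h1 := (hS hy i).1
    have h2 := (hS hz i).2
    have h3 := hx i
    constructor <;> linarith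

theorem C1_hull :
    intervalHull3 C1 = {x : EuclideanSpace ℝ (Fin 3) | ∀ i, -1 ≤ x i ∧ x i ≤ 1} := by
  have h1 : pt 1 1 (-1) ∈ C1 := subset_convexHull ℝ _ (by simp)
  have h2 : pt (-1) 1 1 ∈ C1 := subset_convexHull ℝ _ (by simp)
  have h3 : pt 1 (-1) 1 ∈ C1 := subset_convexHull ℝ _ (by simp)
  have h4 : pt 1 1 1 ∈ C1 := subset_convexHull ℝ _ (by simp)
  refine hull_eq C1 C1_box ?_ ?_
  · intro i
    fin_cases i
    · exact ⟨_, h2, by simp [pt]⟩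
    · exact ⟨_, h3, by simp [pt]⟩
    · exact ⟨_, h1, by simp [pt]⟩
  · intro i
    exact ⟨_, h4, by fin_cases i <;> simp [pt]⟩

theorem C2_hull :
    intervalHull3 C2 = {x : EuclideanSpace ℝ (Fin 3) | ∀ i, -1 ≤ x i ∧ x i ≤ 1} := by
  have h1 : pt 1 (-1) (-1) ∈ C2 := subset_convexHull ℝ _ (by simp)
  have h2 : pt (-1) 1 (-1) ∈ C2 := subset_convexHull ℝ _ (by simp)
  have h3 : pt (-1) (-1) 1 ∈ C2 := subset_convexHull ℝ _ (by simp)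
  have h4 : pt (-1) (-1) (-1) ∈ C2 := subset_convexHull ℝ _ (by simp)
  refine hull_eq C2 C2_box ?_ ?_
  · intro i
    exact ⟨_, h4, by fin_cases i <;> simp [pt]⟩
  · intro i
    fin_cases i
    · exact ⟨_, h1, by simp [pt]⟩
    · exact ⟨_, h2, by simp [pt]⟩
    · exact ⟨_, h3, by simp [pt]⟩

/-- `C₁, C₂ ⊆ ℝ³` are nonempty compact convex sets, separated by the
vector `(1,1,1)` (hence disjoint), both with interval hull `[−1,1]³`, yet neither
contains the midpoint `(0,0,0)` of this interval hull.  Hence in `ℝ³` a nonempty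
compact convex set need not contain the midpoint of its interval hull. -/
theorem counterexample_interval_hull_midpoint_R3 :
    C1.Nonempty ∧ C2.Nonempty ∧
    IsCompact C1 ∧ IsCompact C2 ∧
    Convex ℝ C1 ∧ Convex ℝ C2 ∧
    (∀ x ∈ C1, 1 ≤ ⟪pt 1 1 1, x⟫) ∧
    (∀ y ∈ C2, ⟪pt 1 1 1, y⟫ ≤ -1) ∧
    C1 ∩ C2 = ∅ ∧
    intervalHull3 C1 = {x : EuclideanSpace ℝ (Fin 3) | ∀ i, -1 ≤ x i ∧ x i ≤ 1} ∧
    intervalHull3 C2 = {x : EuclideanSpace ℝ (Fin 3) | ∀ i, -1 ≤ x i ∧ x i ≤ 1} ∧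
    (0 : EuclideanSpace ℝ (Fin 3)) ∉ C1 ∧
    (0 : EuclideanSpace ℝ (Fin 3)) ∉ C2 := by
  refine ⟨⟨_, subset_convexHull ℝ _ (mem_insert _ _)⟩, ⟨_, subset_convexHull ℝ _ (mem_insert _ _)⟩,
    Set.Finite.isCompact_convexHull ℝ (by simp), Set.Finite.isCompact_convexHull ℝ (by simp),
    convex_convexHull ℝ _, convex_convexHull ℝ _, C1_inner, C2_inner, ?_, C1_hull, C2_hull, ?_, ?_⟩
  · ext x
    simp only [mem_inter_iff, mem_empty_iff_false, iff_false]
    rintro ⟨h1, h2⟩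
    have := C1_inner x h1
    have := C2_inner x h2
    linarith
  · intro h
    have := C1_inner 0 h
    norm_num at this
  · intro h
    have := C2_inner 0 h
    norm_num at this
end
end

section
/- Define f : ℝ³ → ℝ by f(x) := max{x₁+x₂−x₃, x₂+x₃−x₁, x₃+x₁−x₂} and φ : ℝ³ → ℝ by φ(x) := max{x₁−x₂−x₃, x₂−x₃−x₁, x₃−x₁−x₂}. Then f and φ are convex; their one-sided directional derivatives at 0 agree in all six directions ±e₁, ±e₂, ±e₃ (each such directional derivative equals 1 for both functions), so in particular both compass-type difference vectors at 0 are zero; yet the subdifferentials ∂f(0) and ∂φ(0) are disjoint. Hence directional derivatives in the coordinate and negative coordinate directions do not determine a common subgradient for trivariate convex functions. -/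
open Filter Topology Set
open scoped RealInnerProductSpace

noncomputable section

/-- The convex subdifferential of `f` at `x`:
`∂f(x) = {s : f(y) ≥ f(x) + ⟨s, y − x⟩ ∀ y}`. -/
def subdiff (f : EuclideanSpace ℝ (Fin 3) → ℝ) (x : EuclideanSpace ℝ (Fin 3)) :
    Set (EuclideanSpace ℝ (Fin 3)) :=
  {s | ∀ y : EuclideanSpace ℝ (Fin 3), f x + ⟪s, y - x⟫ ≤ f y}

/-- The `i`-th standard unit vector of `ℝ³`. -/
def e3 (i : Fin 3) : EuclideanSpace ℝ (Fin 3) := EuclideanSpace.single i 1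

/-- `f(x) = max{x₁+x₂−x₃, x₂+x₃−x₁, x₃+x₁−x₂}`. -/
def f12 (x : EuclideanSpace ℝ (Fin 3)) : ℝ :=
  max (x 0 + x 1 - x 2) (max (x 1 + x 2 - x 0) (x 2 + x 0 - x 1))

/-- `φ(x) = max{x₁−x₂−x₃, x₂−x₃−x₁, x₃−x₁−x₂}`. -/
def phi12 (x : EuclideanSpace ℝ (Fin 3)) : ℝ :=
  max (x 0 - x 1 - x 2) (max (x 1 - x 2 - x 0) (x 2 - x 0 - x 1))

theorem hasDirDeriv_of_eq (f : EuclideanSpace ℝ (Fin 3) → ℝ) (d : EuclideanSpace ℝ (Fin 3))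
    (h0 : f 0 = 0) (h : ∀ t : ℝ, 0 < t → f (t • d) = t) : HasDirDeriv f 0 d 1 := by
  unfold HasDirDeriv
  refine tendsto_const_nhds.congr' ?_
  filter_upwards [self_mem_nhdsWithin] with t ht
  have ht' : 0 < t := ht
  rw [zero_add, h t ht', h0, sub_zero, div_self ht'.ne']

theorem convexOn_max3 (a b c : EuclideanSpace ℝ (Fin 3) →ₗ[ℝ] ℝ) :
    ConvexOn ℝ univ (fun x => max (a x) (max (b x) (c x))) :=
  (a.convexOn convex_univ).sup ((b.convexOn convex_univ).sup (c.convexOn convex_univ))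

theorem f12_convex : ConvexOn ℝ univ f12 := by
  let p (i : Fin 3) : EuclideanSpace ℝ (Fin 3) →ₗ[ℝ] ℝ := (EuclideanSpace.proj i).toLinearMap
  exact convexOn_max3 (p 0 + p 1 - p 2) (p 1 + p 2 - p 0) (p 2 + p 0 - p 1)

theorem phi12_convex : ConvexOn ℝ univ phi12 := by
  let p (i : Fin 3) : EuclideanSpace ℝ (Fin 3) →ₗ[ℝ] ℝ := (EuclideanSpace.proj i).toLinearMap
  exact convexOn_max3 (p 0 - p 1 - p 2) (p 1 - p 2 - p 0) (p 2 - p 0 - p 1)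

theorem dirs12 (i : Fin 3) :
    HasDirDeriv f12 0 (e3 i) 1 ∧ HasDirDeriv f12 0 (-(e3 i)) 1 ∧
    HasDirDeriv phi12 0 (e3 i) 1 ∧ HasDirDeriv phi12 0 (-(e3 i)) 1 := by
  refine ⟨?_, ?_, ?_, ?_⟩ <;> apply hasDirDeriv_of_eq
  all_goals first
    | (simp [f12, phi12]; done)
    | (intro t ht
       fin_cases i <;> simp [f12, phi12, e3] <;> grind)

theorem subdiff12 : subdiff f12 0 ∩ subdiff phi12 0 = ∅ := by
  ext s
  simp only [mem_inter_iff, mem_empty_iff_false, iff_false, not_and]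
  intro h1 h2
  have h1 := h1 (!₂[-1, -1, -1])
  have h2 := h2 (!₂[1, 1, 1])
  simp [f12, phi12, PiLp.inner_apply, Fin.sum_univ_three] at h1 h2
  linarith

/-- `f` and `φ` are convex, all six directional derivatives at `0` in
the directions `±eᵢ` equal `1` for both functions (so both compass-type difference
vectors at `0` are zero), yet `∂f(0)` and `∂φ(0)` are disjoint. -/
theorem counterexample_trivariate_compass :
    ConvexOn ℝ univ f12 ∧ ConvexOn ℝ univ phi12 ∧
    (∀ i : Fin 3,
      HasDirDeriv f12 0 (e3 i) 1 ∧ HasDirDeriv f12 0 (-(e3 i)) 1 ∧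
      HasDirDeriv phi12 0 (e3 i) 1 ∧ HasDirDeriv phi12 0 (-(e3 i)) 1) ∧
    (∀ i : Fin 3,
      (dirDeriv f12 0 (e3 i) - dirDeriv f12 0 (-(e3 i))) / 2 = 0 ∧
      (dirDeriv phi12 0 (e3 i) - dirDeriv phi12 0 (-(e3 i))) / 2 = 0) ∧
    subdiff f12 0 ∩ subdiff phi12 0 = ∅ := by
  refine ⟨f12_convex, phi12_convex, dirs12, fun i => ?_, subdiff12⟩
  obtain ⟨h1, h2, h3, h4⟩ := dirs12 i
  have e1 : dirDeriv f12 0 (e3 i) = 1 := Tendsto.limUnder_eq h1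
  have e2 : dirDeriv f12 0 (-(e3 i)) = 1 := Tendsto.limUnder_eq h2
  have e3' : dirDeriv phi12 0 (e3 i) = 1 := Tendsto.limUnder_eq h3
  have e4 : dirDeriv phi12 0 (-(e3 i)) = 1 := Tendsto.limUnder_eq h4
  rw [e1, e2, e3', e4]
  norm_num
end
end

section
/- There exist nonempty compact convex sets T₁, T₂, T₃ ⊆ ℝ² and nonzero vectors u, v, w ∈ ℝ² such that the support functions of T₁, T₂, T₃ all agree at u, v, and w (with σ_{T_i}(u) = σ_{T_i}(v) = σ_{T_i}(w) = 1 for each i ∈ {1,2,3}), and yet T₁ ∩ T₂ ∩ T₃ = ∅. Consequently, three support-function evaluations (equivalently, three directional-derivative evaluations of a convex function) are in general insufficient to determine an element of a compact convex set in ℝ². -/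
open Set
open scoped RealInnerProductSpace

noncomputable section

/-- The support function `σ_C(d) = sup{⟨d, x⟩ : x ∈ C}` (as a real number, which is
the correct value for nonempty compact `C`). -/
def suppFn (C : Set (EuclideanSpace ℝ (Fin 2))) (d : EuclideanSpace ℝ (Fin 2)) : ℝ :=
  sSup ((fun x => ⟪d, x⟫) '' C)

/-- The support function of a segment, at a direction maximal at the first endpoint. -/
theorem suppFn_segment_left (p q d : EuclideanSpace ℝ (Fin 2))
    (hp : ⟪d, p⟫ = 1) (hq : ⟪d, q⟫ ≤ 1) : suppFn (segment ℝ p q) d = 1 := by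
  apply IsGreatest.csSup_eq
  refine ⟨⟨p, left_mem_segment ℝ p q, hp⟩, ?_⟩
  rintro _ ⟨x, ⟨a, b, ha, hb, hab, rfl⟩, rfl⟩
  simp only [inner_add_right, inner_smul_right, hp]
  nlinarith

theorem suppFn_segment_right (p q d : EuclideanSpace ℝ (Fin 2))
    (hp : ⟪d, p⟫ ≤ 1) (hq : ⟪d, q⟫ = 1) : suppFn (segment ℝ p q) d = 1 := by
  rw [segment_symm]
  exact suppFn_segment_left q p d hq hp

theorem isCompact_segment_plane (p q : EuclideanSpace ℝ (Fin 2)) :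
    IsCompact (segment ℝ p q) := by
  rw [← convexHull_pair]
  exact (Set.toFinite {p, q}).isCompact_convexHull ℝ

/-- there are nonempty compact convex sets `T₁, T₂, T₃ ⊆ ℝ²` and nonzero
vectors `u, v, w` with `σ_{Tᵢ}(u) = σ_{Tᵢ}(v) = σ_{Tᵢ}(w) = 1` for each `i`, yet
`T₁ ∩ T₂ ∩ T₃ = ∅`: three support-function evaluations cannot determine an element of
a compact convex set in `ℝ²`. -/
theorem three_support_evaluations_insufficient :
    ∃ T : Fin 3 → Set (EuclideanSpace ℝ (Fin 2)),
      ∃ u v w : EuclideanSpace ℝ (Fin 2),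
        u ≠ 0 ∧ v ≠ 0 ∧ w ≠ 0 ∧
        (∀ i : Fin 3, (T i).Nonempty ∧ IsCompact (T i) ∧ Convex ℝ (T i)) ∧
        (∀ i : Fin 3, suppFn (T i) u = 1 ∧ suppFn (T i) v = 1 ∧ suppFn (T i) w = 1) ∧
        T 0 ∩ T 1 ∩ T 2 = ∅ := by
  -- the three edges of the triangle cut out by `x ≤ 1`, `y ≤ 1`, `-x - y ≤ 1`
  refine ⟨![segment ℝ !₂[1, 1] !₂[1, -2], segment ℝ !₂[1, 1] !₂[-2, 1],
    segment ℝ !₂[1, -2] !₂[-2, 1]], !₂[1, 0], !₂[0, 1], !₂[-1, -1], ?_, ?_, ?_, ?_, ?_, ?_⟩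
  · intro h
    have := congrArg (fun x : EuclideanSpace ℝ (Fin 2) => x 0) h
    simp at this
  · intro h
    have := congrArg (fun x : EuclideanSpace ℝ (Fin 2) => x 1) h
    simp at this
  · intro h
    have := congrArg (fun x : EuclideanSpace ℝ (Fin 2) => x 0) h
    simp at this
  · intro i
    fin_cases i
    all_goals exact ⟨⟨_, left_mem_segment ℝ _ _⟩, isCompact_segment_plane _ _, convex_segment _ _⟩
  · intro i
    fin_cases i
    all_goals
      refine ⟨?_, ?_, ?_⟩
      all_goals
        first
        | (apply suppFn_segment_left <;> norm_num [PiLp.inner_apply, Fin.sum_univ_two]; done)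
        | (apply suppFn_segment_right <;> norm_num [PiLp.inner_apply, Fin.sum_univ_two]; done)
  · rw [Set.eq_empty_iff_forall_notMem]
    rintro x ⟨⟨⟨a, b, ha, hb, hab, h0⟩, ⟨c, d, hc, hd, hcd, h1⟩⟩, ⟨e, f, he, hf, hef, h2⟩⟩
    have k0 := congrArg (fun x : EuclideanSpace ℝ (Fin 2) => x 0) h0
    have k1 := congrArg (fun x : EuclideanSpace ℝ (Fin 2) => x 1) h1
    have k2 := congrArg (fun x : EuclideanSpace ℝ (Fin 2) => x 0) h2
    have k3 := congrArg (fun x : EuclideanSpace ℝ (Fin 2) => x 1) h2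
    simp at k0 k1 k2 k3
    linarith
end
end

section
/- Let C ⊆ ℝⁿ be a nonempty compact set, let Z be an open superset of C, and let f : ℝ² × Z → ℝ be continuously differentiable. Define the optimal-value function φ : ℝ² → ℝ by φ(x) := min{ f(x,y) : y ∈ C }. Fix x̂ ∈ ℝ², let Y := { ŷ ∈ C : f(x̂,ŷ) ≤ f(x̂,y) for all y ∈ C } be the solution set, and for each d ∈ ℝ² let ψ(d) := min{ ⟨d, ∇ₓf(x̂,y)⟩ : y ∈ Y }, where ∇ₓf denotes the gradient of f with respect to its first (ℝ²-valued) argument. Then φ is locally Lipschitz continuous and directionally differentiable, with φ'(x̂;d) = ψ(d) for every d ∈ ℝ², and the vector ½·( ψ(1,0) − ψ(−1,0), ψ(0,1) − ψ(0,−1) ) is an element of Clarke's generalized gradient ∂φ(x̂). -/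
open Filter Topology Set
open scoped RealInnerProductSpace

noncomputable section

section helpers

variable {E F : Type*} [NormedAddCommGroup E] [NormedSpace ℝ E]
  [NormedAddCommGroup F] [NormedSpace ℝ F]

lemma ov_contDiffAt {C Z : Set F} (hZ : IsOpen Z) (hCZ : C ⊆ Z) {f : E × F → ℝ}
    (hf : ContDiffOn ℝ 1 f (univ ×ˢ Z)) (x : E) {y : F} (hy : y ∈ C) :
    ContDiffAt ℝ 1 f (x, y) :=
  hf.contDiffAt ((isOpen_univ.prod hZ).mem_nhds ⟨mem_univ _, hCZ hy⟩)

lemma ov_fderiv {C Z : Set F} (hZ : IsOpen Z) (hCZ : C ⊆ Z) {f : E × F → ℝ}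
    (hf : ContDiffOn ℝ 1 f (univ ×ˢ Z)) (x : E) {y : F} (hy : y ∈ C) (d : E) :
    fderiv ℝ (fun x => f (x, y)) x d = fderiv ℝ f (x, y) (d, 0) := by
  have h1 := ((ov_contDiffAt hZ hCZ hf x hy).differentiableAt (by norm_num)).hasFDerivAt
  have h2 : HasFDerivAt (fun x : E => (x, y)) (ContinuousLinearMap.inl ℝ E F) x :=
    hasFDerivAt_prodMk_left x y
  have h3 := (h1.comp x h2).fderiv
  have h4 : fderiv ℝ (fun x => f (x, y)) x
      = (fderiv ℝ f (x, y)).comp (ContinuousLinearMap.inl ℝ E F) := h3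
  rw [h4]; simp

lemma ov_bound {C Z : Set F} (hC : IsCompact C) (hZ : IsOpen Z) (hCZ : C ⊆ Z)
    {f : E × F → ℝ} (hf : ContDiffOn ℝ 1 f (univ ×ˢ Z)) (x : E) :
    ∃ K : NNReal, ∀ y ∈ C, ‖fderiv ℝ f (x, y)‖₊ < K := by
  have hc : ContinuousOn (fun y => fderiv ℝ f (x, y)) C := by
    have := hf.continuousOn_fderiv_of_isOpen (isOpen_univ.prod hZ) le_rfl
    exact this.comp (by fun_prop) (fun y hy => ⟨mem_univ _, hCZ hy⟩)
  obtain ⟨K, hK⟩ := hC.exists_bound_of_continuousOn hc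
  refine ⟨(K + 1).toNNReal, fun y hy => ?_⟩
  rw [Real.lt_toNNReal_iff_coe_lt]
  have := hK y hy
  simp only [coe_nnnorm]
  linarith

lemma ov_min {C Z : Set F} (hCne : C.Nonempty) (hC : IsCompact C) (hCZ : C ⊆ Z)
    {f : E × F → ℝ} (hf : ContDiffOn ℝ 1 f (univ ×ˢ Z)) (x : E) :
    (∃ y ∈ C, sInf ((fun y => f (x, y)) '' C) = f (x, y)) ∧
    ∀ y ∈ C, sInf ((fun y => f (x, y)) '' C) ≤ f (x, y) := by
  have hc : ContinuousOn (fun y => f (x, y)) C :=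
    hf.continuousOn.comp (by fun_prop) (fun y hy => ⟨mem_univ _, hCZ hy⟩)
  obtain ⟨y, hy, hm⟩ := hC.exists_isMinOn hCne hc
  have hl : IsLeast ((fun y => f (x, y)) '' C) (f (x, y)) :=
    ⟨⟨y, hy, rfl⟩, by rintro _ ⟨z, hz, rfl⟩; exact hm hz⟩
  refine ⟨⟨y, hy, hl.csInf_eq⟩, fun z hz => ?_⟩
  rw [hl.csInf_eq]; exact hm hz

lemma ov_lip {C Z : Set F} (hCne : C.Nonempty) (hC : IsCompact C) (hZ : IsOpen Z)
    (hCZ : C ⊆ Z) {f : E × F → ℝ} (hf : ContDiffOn ℝ 1 f (univ ×ˢ Z))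
    {φ : E → ℝ} (hφ : φ = fun x => sInf ((fun y => f (x, y)) '' C)) :
    LocallyLipschitz φ := by
  intro x
  obtain ⟨K, hK⟩ := ov_bound hC hZ hCZ hf x
  have key : ∀ᶠ p : E × E in 𝓝 (x, x), ∀ y ∈ C,
      |f (p.1, y) - f (p.2, y)| ≤ K * ‖p.1 - p.2‖ := by
    apply hC.eventually_forall_of_forall_eventually
    intro y hy
    obtain ⟨t, ht, hL⟩ :=
      (ov_contDiffAt hZ hCZ hf x hy).exists_lipschitzOnWith_of_nnnorm_lt K (hK y hy)
    have c1 : Tendsto (fun z : (E × E) × F => (z.1.1, z.2)) (𝓝 ((x, x), y)) (𝓝 (x, y)) :=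
      Continuous.tendsto (by fun_prop) ((x, x), y)
    have c2 : Tendsto (fun z : (E × E) × F => (z.1.2, z.2)) (𝓝 ((x, x), y)) (𝓝 (x, y)) :=
      Continuous.tendsto (by fun_prop) ((x, x), y)
    filter_upwards [c1 ht, c2 ht] with z h1 h2
    have := hL.dist_le_mul _ h1 _ h2
    rw [Real.dist_eq, dist_eq_norm] at this
    refine this.trans (le_of_eq ?_)
    simp [Prod.norm_def]
  have key' : ∀ p : E × E, (∀ y ∈ C, |f (p.1, y) - f (p.2, y)| ≤ K * ‖p.1 - p.2‖) →
      φ p.1 ≤ φ p.2 + K * ‖p.1 - p.2‖ := by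
    intro p hp
    subst hφ
    obtain ⟨y, hy, he⟩ := (ov_min hCne hC hCZ hf p.2).1
    have h1 := (ov_min hCne hC hCZ hf p.1).2 y hy
    have h2 := (abs_le.1 (hp y hy)).2
    simp only
    linarith
  rw [nhds_prod_eq] at key
  obtain ⟨U, hU, hUU⟩ := eventually_prod_self_iff'.1 key
  refine ⟨K, U, hU, LipschitzOnWith.of_dist_le_mul ?_⟩
  intro a ha b hb
  rw [Real.dist_eq, dist_eq_norm, abs_le]
  have h1 := key' (a, b) (hUU a ha b hb)
  have h2 := key' (b, a) (hUU b hb a ha)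
  simp only [norm_sub_rev b a] at h1 h2
  constructor <;> linarith

lemma ov_Y {C Z : Set F} (hCne : C.Nonempty) (hC : IsCompact C) (hZ : IsOpen Z)
    (hCZ : C ⊆ Z) {f : E × F → ℝ} (hf : ContDiffOn ℝ 1 f (univ ×ˢ Z)) (x d : E)
    {Y : Set F} (hY : Y = {yh ∈ C | ∀ y ∈ C, f (x, yh) ≤ f (x, y)}) :
    Y.Nonempty ∧ BddBelow ((fun y => fderiv ℝ (fun x => f (x, y)) x d) '' Y) := by
  constructor
  · obtain ⟨⟨y, hy, he⟩, h⟩ := ov_min hCne hC hCZ hf x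
    rw [hY]
    exact ⟨y, hy, by rw [← he]; exact h⟩
  · obtain ⟨K, hK⟩ := ov_bound hC hZ hCZ hf x
    refine ⟨-(K * ‖d‖), ?_⟩
    rintro _ ⟨y, hy, rfl⟩
    rw [hY] at hy
    simp only
    rw [ov_fderiv hZ hCZ hf x hy.1]
    have h1 := (fderiv ℝ f (x, y)).le_opNorm (d, 0)
    have h2 : ‖fderiv ℝ f (x, y)‖ ≤ K := (hK y hy.1).le
    have h3 : ‖((d, 0) : E × F)‖ = ‖d‖ := by simp [Prod.norm_def]
    rw [h3, Real.norm_eq_abs] at h1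
    have h4 := mul_le_mul_of_nonneg_right h2 (norm_nonneg d)
    have := (abs_le.1 h1).1
    linarith

lemma ov_danskin {C Z : Set F} (hCne : C.Nonempty) (hC : IsCompact C) (hZ : IsOpen Z)
    (hCZ : C ⊆ Z) {f : E × F → ℝ} (hf : ContDiffOn ℝ 1 f (univ ×ˢ Z))
    {φ : E → ℝ} (hφ : φ = fun x => sInf ((fun y => f (x, y)) '' C)) (x d : E)
    {Y : Set F} (hY : Y = {yh ∈ C | ∀ y ∈ C, f (x, yh) ≤ f (x, y)}) :
    HasDirDeriv φ x d (sInf ((fun y => fderiv ℝ (fun x => f (x, y)) x d) '' Y)) := by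
  obtain ⟨hYne, hbdd⟩ := ov_Y hCne hC hZ hCZ hf x d hY
  have hφc : Continuous φ := (ov_lip hCne hC hZ hCZ hf hφ).continuous
  have hmin : ∀ x, (∃ y ∈ C, φ x = f (x, y)) ∧ ∀ y ∈ C, φ x ≤ f (x, y) := by
    subst hφ; exact ov_min hCne hC hCZ hf
  have hYeq : ∀ y ∈ Y, y ∈ C ∧ φ x = f (x, y) := by
    intro y hy
    rw [hY] at hy
    refine ⟨hy.1, le_antisymm ((hmin x).2 y hy.1) ?_⟩
    obtain ⟨z, hz, he⟩ := (hmin x).1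
    rw [he]; exact hy.2 z hz
  set m := sInf ((fun y => fderiv ℝ (fun x => f (x, y)) x d) '' Y) with hm
  have strict : ∀ y₀ ∈ C, ∀ ε > 0, ∀ᶠ q : ℝ × F in 𝓝 ((0 : ℝ), y₀),
      |f (x + q.1 • d, q.2) - f (x, q.2) - q.1 * fderiv ℝ (fun x => f (x, y₀)) x d|
        ≤ ε * |q.1| := by
    intro y₀ hy₀ ε hε
    have hs := (ov_contDiffAt hZ hCZ hf x hy₀).hasStrictFDerivAt (by norm_num)
    have hδ : 0 < ε / (‖d‖ + 1) := by positivity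
    have hb := hs.isLittleO.def hδ
    have ct : Tendsto (fun q : ℝ × F => ((x + q.1 • d, q.2), (x, q.2))) (𝓝 ((0 : ℝ), y₀))
        (𝓝 ((x, y₀), (x, y₀))) := by
      have : Continuous (fun q : ℝ × F => ((x + q.1 • d, q.2), (x, q.2))) := by fun_prop
      have := this.tendsto ((0 : ℝ), y₀)
      simpa using this
    filter_upwards [ct.eventually hb] with q hq
    rw [ov_fderiv hZ hCZ hf x hy₀]
    have e1 : ((x + q.1 • d, q.2) - (x, q.2) : E × F) = q.1 • (d, 0) := by
      ext <;> simp
    simp only [e1, map_smul, norm_smul, smul_eq_mul, Real.norm_eq_abs] at hq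
    have h3 : ‖((d, 0) : E × F)‖ = ‖d‖ := by simp [Prod.norm_def]
    rw [h3] at hq
    refine hq.trans ?_
    have : ε / (‖d‖ + 1) * ‖d‖ ≤ ε := by
      rw [div_mul_eq_mul_div, div_le_iff₀ (by positivity)]
      nlinarith [norm_nonneg d]
    nlinarith [abs_nonneg q.1]
  have lower : ∀ ε > 0, ∀ᶠ t : ℝ in 𝓝[>] 0, m - ε ≤ (φ (x + t • d) - φ x) / t := by
    intro ε hε
    have key : ∀ᶠ t : ℝ in 𝓝 0, ∀ y ∈ C,
        (0 < t → t * (m - ε) ≤ f (x + t • d, y) - f (x, y)) ∨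
          φ (x + t • d) < f (x + t • d, y) := by
      apply hC.eventually_forall_of_forall_eventually
      intro y₀ hy₀
      by_cases hy : y₀ ∈ Y
      · filter_upwards [strict y₀ hy₀ ε hε] with q hq
        left
        intro hpos
        have h1 : m ≤ fderiv ℝ (fun x => f (x, y₀)) x d := csInf_le hbdd ⟨y₀, hy, rfl⟩
        rw [abs_of_pos hpos] at hq
        have h2 := (abs_le.1 hq).1
        have h3 := mul_le_mul_of_nonneg_left h1 hpos.le
        linarith
      · have hlt : φ x < f (x, y₀) := by
          by_contra hcon
          apply hy
          rw [hY]
          exact ⟨hy₀, fun z hz => (not_lt.1 hcon).trans ((hmin x).2 z hz)⟩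
        have ct : Tendsto (fun q : ℝ × F => (x + q.1 • d, q.2)) (𝓝 ((0 : ℝ), y₀))
            (𝓝 (x, y₀)) := by
          have : Continuous (fun q : ℝ × F => (x + q.1 • d, q.2)) := by fun_prop
          simpa using this.tendsto ((0 : ℝ), y₀)
        have t1 := (ov_contDiffAt hZ hCZ hf x hy₀).continuousAt.tendsto.comp ct
        have t2 : Tendsto (fun q : ℝ × F => φ (x + q.1 • d)) (𝓝 ((0 : ℝ), y₀)) (𝓝 (φ x)) := by
          have : Continuous (fun q : ℝ × F => φ (x + q.1 • d)) := by fun_prop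
          simpa using this.tendsto ((0 : ℝ), y₀)
        filter_upwards [t2.eventually_lt t1 hlt] with q hq
        exact Or.inr hq
    filter_upwards [nhdsWithin_le_nhds key, self_mem_nhdsWithin] with t ht hpos
    have hpos : 0 < t := hpos
    obtain ⟨y, hy, he⟩ := (hmin (x + t • d)).1
    rw [le_div_iff₀ hpos]
    rcases ht y hy with h | h
    · have h1 := h hpos
      have h2 := (hmin x).2 y hy
      linarith
    · exact absurd he h.ne
  have upper : ∀ ε > 0, ∀ᶠ t : ℝ in 𝓝[>] 0, (φ (x + t • d) - φ x) / t ≤ m + ε := by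
    intro ε hε
    obtain ⟨_, ⟨y, hy, rfl⟩, hlt⟩ :=
      exists_lt_of_csInf_lt (hYne.image _) (show m < m + ε / 2 by linarith)
    have ct : Tendsto (fun t : ℝ => (t, y)) (𝓝 0) (𝓝 ((0 : ℝ), y)) :=
      Continuous.tendsto (by fun_prop) 0
    have hs := ct.eventually (strict y (hYeq y hy).1 (ε / 2) (by linarith))
    filter_upwards [nhdsWithin_le_nhds hs, self_mem_nhdsWithin] with t ht hpos
    have hpos : 0 < t := hpos
    rw [div_le_iff₀ hpos]
    rw [abs_of_pos hpos] at ht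
    have h1 := (abs_le.1 ht).2
    have h2 := (hmin (x + t • d)).2 y (hYeq y hy).1
    have h3 := (hYeq y hy).2
    have h4 := mul_le_mul_of_nonneg_left hlt.le hpos.le
    simp only at h1 h4
    linarith
  unfold HasDirDeriv
  rw [Metric.tendsto_nhds]
  intro ε hε
  filter_upwards [lower (ε / 2) (by linarith), upper (ε / 2) (by linarith)] with t h1 h2
  rw [Real.dist_eq, abs_lt]
  constructor <;> linarith

lemma ov_clarke {φ : E → ℝ} (hL : LocallyLipschitz φ) (x d : E) (L : ℝ)
    (h : HasDirDeriv φ x (-d) L) : -L ≤ clarkeDD φ x d := by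
  have ct : Tendsto (fun t : ℝ => (x + t • (-d), t)) (𝓝[>] 0) (𝓝 x ×ˢ 𝓝[>] (0 : ℝ)) := by
    refine Tendsto.prodMk ?_ tendsto_id
    have : Continuous (fun t : ℝ => x + t • (-d)) := by fun_prop
    have := this.tendsto 0
    simp only [zero_smul, add_zero] at this
    exact this.mono_left nhdsWithin_le_nhds
  have hlim : Tendsto ((fun q : E × ℝ => (φ (q.1 + q.2 • d) - φ q.1) / q.2) ∘
      (fun t : ℝ => (x + t • (-d), t))) (𝓝[>] 0) (𝓝 (-L)) := by
    refine (Tendsto.neg h).congr fun t => ?_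
    simp only [Function.comp, smul_neg, neg_add_cancel_right]
    ring
  have hb : ∃ B : ℝ, ∀ᶠ q : E × ℝ in 𝓝 x ×ˢ 𝓝[>] (0 : ℝ),
      (φ (q.1 + q.2 • d) - φ q.1) / q.2 ≤ B := by
    obtain ⟨K, U, hU, hK⟩ := hL x
    refine ⟨K * ‖d‖, ?_⟩
    have c1 : Tendsto (fun q : E × ℝ => q.1 + q.2 • d) (𝓝 x ×ˢ 𝓝[>] (0 : ℝ)) (𝓝 x) := by
      have : Continuous (fun q : E × ℝ => q.1 + q.2 • d) := by fun_prop
      have := this.tendsto (x, 0)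
      simp only [zero_smul, add_zero, nhds_prod_eq] at this
      exact this.mono_left (Filter.prod_mono le_rfl nhdsWithin_le_nhds)
    have c2 : Tendsto (fun q : E × ℝ => q.1) (𝓝 x ×ˢ 𝓝[>] (0 : ℝ)) (𝓝 x) := tendsto_fst
    have c3 : ∀ᶠ q : E × ℝ in 𝓝 x ×ˢ 𝓝[>] (0 : ℝ), q.2 ∈ Ioi (0 : ℝ) :=
      tendsto_snd.eventually self_mem_nhdsWithin
    filter_upwards [c1 hU, c2 hU, c3] with q h1 h2 h3
    have h3 : 0 < q.2 := h3
    rw [div_le_iff₀ h3]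
    have := hK.dist_le_mul _ h1 _ h2
    rw [Real.dist_eq, dist_eq_norm, add_sub_cancel_left, norm_smul, Real.norm_eq_abs,
      abs_of_pos h3] at this
    have := (abs_le.1 this).2
    linarith
  obtain ⟨B, hB⟩ := hb
  unfold clarkeDD
  rw [← hlim.limsup_eq, Filter.limsup_comp]
  refine limsup_le_limsup_of_le ct ?_ ⟨B, hB⟩
  have : IsBoundedUnder (· ≥ ·) (map (fun t : ℝ => (x + t • (-d), t)) (𝓝[>] 0))
      (fun q : E × ℝ => (φ (q.1 + q.2 • d) - φ q.1) / q.2) := by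
    have := hlim.isBoundedUnder_ge
    simpa [IsBoundedUnder, Filter.map_map] using this
  exact this.isCoboundedUnder_le

end helpers

/-- Danskin-type subgradient for optimal-value functions.  With
`φ(x) = min{f(x,y) : y ∈ C}`, solution set `Y` at `x̂`, and
`ψ(d) = min{⟨d, ∇ₓf(x̂,y)⟩ : y ∈ Y}`, the function `φ` is locally Lipschitz and
directionally differentiable with `φ'(x̂;d) = ψ(d)`, and
`½(ψ(1,0) − ψ(−1,0), ψ(0,1) − ψ(0,−1)) ∈ ∂φ(x̂)`. -/
theorem optimal_value_compass_subgradient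
    (n : ℕ) (C Z : Set (EuclideanSpace ℝ (Fin n)))
    (hCne : C.Nonempty) (hCcomp : IsCompact C) (hZ : IsOpen Z) (hCZ : C ⊆ Z)
    (f : EuclideanSpace ℝ (Fin 2) × EuclideanSpace ℝ (Fin n) → ℝ)
    (hf : ContDiffOn ℝ 1 f (univ ×ˢ Z))
    (φ : EuclideanSpace ℝ (Fin 2) → ℝ)
    (hφ : φ = fun x => sInf ((fun y => f (x, y)) '' C))
    (xh : EuclideanSpace ℝ (Fin 2))
    (Y : Set (EuclideanSpace ℝ (Fin n)))
    (hY : Y = {yh ∈ C | ∀ y ∈ C, f (xh, yh) ≤ f (xh, y)})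
    (ψ : EuclideanSpace ℝ (Fin 2) → ℝ)
    (hψ : ψ = fun d =>
      sInf ((fun y => fderiv ℝ (fun x => f (x, y)) xh d) '' Y)) :
    LocallyLipschitz φ ∧
    (∀ x, DirDiffAt φ x) ∧
    (∀ d, HasDirDeriv φ xh d (ψ d)) ∧
    (∑ i : Fin 2, ((ψ (e2 i) - ψ (-(e2 i))) / 2) • e2 i) ∈ clarkeGrad φ xh := by


  have hlip := ov_lip hCne hCcomp hZ hCZ hf hφ
  have hdir : ∀ d, HasDirDeriv φ xh d (ψ d) := by
    intro d
    rw [hψ]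
    exact ov_danskin hCne hCcomp hZ hCZ hf hφ xh d hY
  refine ⟨hlip, fun x d => ⟨_, ov_danskin hCne hCcomp hZ hCZ hf hφ x d rfl⟩, hdir, ?_⟩
  have hsup : ∀ u v, ψ u + ψ v ≤ ψ (u + v) := by
    intro u v
    rw [hψ]
    obtain ⟨hne, hbu⟩ := ov_Y hCne hCcomp hZ hCZ hf xh u hY
    obtain ⟨-, hbv⟩ := ov_Y hCne hCcomp hZ hCZ hf xh v hY
    refine le_csInf (hne.image _) ?_
    rintro _ ⟨y, hy, rfl⟩
    simp only [map_add]
    exact add_le_add (csInf_le hbu ⟨y, hy, rfl⟩) (csInf_le hbv ⟨y, hy, rfl⟩)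
  have hhom : ∀ (c : ℝ) u, 0 ≤ c → ψ (c • u) = c * ψ u := by
    intro c u hc
    rw [hψ]
    simp only [map_smul]
    rw [← smul_eq_mul, ← Real.sInf_smul_of_nonneg hc, ← Set.image_smul, Set.image_image]
  have hodd : ∀ (c : ℝ) u, ψ (c • u) - ψ (-(c • u)) = c * (ψ u - ψ (-u)) := by
    intro c u
    rcases le_total 0 c with hc | hc
    · rw [← smul_neg, hhom c u hc, hhom c (-u) hc]; ring
    · have h1 : c • u = (-c) • (-u) := by simp
      have h2 : -(c • u) = (-c) • u := by simp
      rw [h2, h1, hhom (-c) u (by linarith), hhom (-c) (-u) (by linarith)]; ring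
  intro d
  refine le_trans ?_ (ov_clarke hlip xh d _ (hdir (-d)))
  have hd : d = d 0 • e2 0 + d 1 • e2 1 := by
    ext i; fin_cases i <;> simp [e2]
  have h1 := hodd (d 0) (e2 0)
  have h2 := hodd (d 1) (e2 1)
  have h3 := hsup (-d) (d 1 • e2 1)
  have h4 := hsup (-d) (d 0 • e2 0)
  have e3 : -d + d 1 • e2 1 = -(d 0 • e2 0) := by
    nth_rewrite 1 [hd]; abel
  have e4 : -d + d 0 • e2 0 = -(d 1 • e2 1) := by
    nth_rewrite 1 [hd]; abel
  rw [e3] at h3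
  rw [e4] at h4
  have hi : ⟪∑ i : Fin 2, ((ψ (e2 i) - ψ (-(e2 i))) / 2) • e2 i, d⟫
      = (ψ (e2 0) - ψ (-(e2 0))) / 2 * d 0 + (ψ (e2 1) - ψ (-(e2 1))) / 2 * d 1 := by
    simp [Fin.sum_univ_two, inner_add_left, inner_smul_left, e2, EuclideanSpace.inner_single_left]
  rw [hi]
  linarith
end
end

section
/- Suppose f : ℝⁿ → ℝⁿ, x₀ : ℝ² → ℝⁿ, and g : ℝ² × ℝⁿ → ℝ are locally Lipschitz continuous and directionally differentiable at every point in every direction. Let t_f > 0 and let x : [0,t_f] × ℝ² → ℝⁿ be such that for each p ∈ ℝ², t ↦ x(t,p) is the unique solution on [0,t_f] of the ODE dx/dt = f(x(t,p)) with x(0,p) = x₀(p), and define the cost function φ : ℝ² → ℝ by φ(p) := g(p, x(t_f,p)). Fix p ∈ ℝ², and for each d ∈ ℝ² let y(·,d) denote a solution on [0,t_f] of dy/dt(t,d) = f'(x(t,p); y(t,d)) with y(0,d) = x₀'(p;d), where f'(z;w) denotes the one-sided directional derivative of f at z in direction w. Then: (i) for each d ∈ ℝ², y(·,d) is the unique such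 solution; and (ii) defining ψ(d) := g'((p, x(t_f,p)); (d, y(t_f,d))), the vector ½·( ψ(1,0) − ψ(−1,0), ψ(0,1) − ψ(0,−1) ) is an element of Clarke's generalized gradient ∂φ(p). -/
open Filter Topology Set
open scoped RealInnerProductSpace

noncomputable section

/-- A (possibly vector-valued) function `h` has one-sided directional derivative `L`
at `z` in direction `w`. -/
def HasDirDerivV {E F : Type*} [NormedAddCommGroup E] [NormedSpace ℝ E]
    [NormedAddCommGroup F] [NormedSpace ℝ F]
    (h : E → F) (z w : E) (L : F) : Prop :=
  Tendsto (fun t : ℝ => t⁻¹ • (h (z + t • w) - h z)) (𝓝[>] (0 : ℝ)) (𝓝 L)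

/-- The one-sided directional derivative of a (possibly vector-valued) function. -/
def dirDerivV {E F : Type*} [NormedAddCommGroup E] [NormedSpace ℝ E]
    [NormedAddCommGroup F] [NormedSpace ℝ F]
    (h : E → F) (z w : E) : F :=
  limUnder (𝓝[>] (0 : ℝ)) (fun t : ℝ => t⁻¹ • (h (z + t • w) - h z))


lemma aux_right {E : Type*} [NormedAddCommGroup E] [NormedSpace ℝ E] {u : ℝ → E} {u' : E}
    {tf t : ℝ} (ht : t ∈ Ico (0 : ℝ) tf) (h : HasDerivWithinAt u u' (Icc (0 : ℝ) tf) t) :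
    HasDerivWithinAt u u' (Ici t) t :=
  h.mono_of_mem_nhdsWithin (mem_of_superset (Icc_mem_nhdsGE ht.2) (Icc_subset_Icc_left ht.1))

lemma HasDirDerivV.norm_sub_le {E F : Type*} [NormedAddCommGroup E] [NormedSpace ℝ E]
    [NormedAddCommGroup F] [NormedSpace ℝ F] {h : E → F} {L : ℝ}
    (hL : ∀ a b, ‖h a - h b‖ ≤ L * ‖a - b‖) {z w w' : E} {D D' : F}
    (h1 : HasDirDerivV h z w D) (h2 : HasDirDerivV h z w' D') : ‖D - D'‖ ≤ L * ‖w - w'‖ := by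
  refine le_of_tendsto (h1.sub h2).norm ?_
  filter_upwards [self_mem_nhdsWithin] with t ht
  have ht : 0 < t := ht
  rw [← smul_sub, norm_smul, norm_inv, Real.norm_eq_abs, abs_of_pos ht, inv_mul_le_iff₀ ht]
  have := hL (z + t • w) (z + t • w')
  rw [show z + t • w - (z + t • w') = t • (w - w') by rw [smul_sub]; abel, norm_smul,
    Real.norm_eq_abs, abs_of_pos ht] at this
  rw [sub_sub_sub_cancel_right]
  linarith

lemma HasDirDerivV.dirDerivV_eq {E F : Type*} [NormedAddCommGroup E] [NormedSpace ℝ E]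
    [NormedAddCommGroup F] [NormedSpace ℝ F] {h : E → F} {z w : E} {D : F}
    (h1 : HasDirDerivV h z w D) : dirDerivV h z w = D := h1.limUnder_eq

lemma dirDerivV_spec {E F : Type*} [NormedAddCommGroup E] [NormedSpace ℝ E]
    [NormedAddCommGroup F] [NormedSpace ℝ F] {h : E → F} {z w : E}
    (h1 : ∃ D, HasDirDerivV h z w D) : HasDirDerivV h z w (dirDerivV h z w) := by
  obtain ⟨D, hD⟩ := h1
  rwa [hD.dirDerivV_eq]

lemma HasDirDerivV.zero_right {E F : Type*} [NormedAddCommGroup E] [NormedSpace ℝ E]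
    [NormedAddCommGroup F] [NormedSpace ℝ F] (h : E → F) (z : E) : HasDirDerivV h z 0 0 := by
  simp [HasDirDerivV]

lemma HasDirDerivV.congr_nhds {E F : Type*} [NormedAddCommGroup E] [NormedSpace ℝ E]
    [NormedAddCommGroup F] [NormedSpace ℝ F] {h k : E → F} {z w : E} {D : F}
    (h1 : HasDirDerivV h z w D) (hk : h =ᶠ[𝓝 z] k) : HasDirDerivV k z w D := by
  refine h1.congr' ?_
  have : Tendsto (fun t : ℝ => z + t • w) (𝓝[>] 0) (𝓝 z) := by
    refine Tendsto.mono_left ?_ nhdsWithin_le_nhds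
    have : Continuous (fun t : ℝ => z + t • w) := by fun_prop
    simpa using this.tendsto 0
  filter_upwards [this hk] with t ht
  have : h (z + t • w) = k (z + t • w) := ht
  rw [this, hk.self_of_nhds]

/-- Directional differentiability of the flow for a globally Lipschitz right-hand side. -/
lemma dir_flow {E : Type*} [NormedAddCommGroup E] [NormedSpace ℝ E] [CompleteSpace E]
    {F : E → E} {L : ℝ} (hL0 : 0 < L) (hL : ∀ a b, ‖F a - F b‖ ≤ L * ‖a - b‖)
    {tf : ℝ} (htf : 0 < tf) {X Y D : ℝ → E} {Xs : ℝ → ℝ → E}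
    (hX : ∀ t ∈ Icc (0 : ℝ) tf, HasDerivWithinAt X (F (X t)) (Icc (0 : ℝ) tf) t)
    (hXs : ∀ᶠ s in 𝓝[>] (0 : ℝ), ∀ t ∈ Icc (0 : ℝ) tf,
      HasDerivWithinAt (Xs s) (F (Xs s t)) (Icc (0 : ℝ) tf) t)
    (hY : ∀ t ∈ Icc (0 : ℝ) tf, HasDerivWithinAt Y (D t) (Icc (0 : ℝ) tf) t)
    (hD : ∀ t ∈ Icc (0 : ℝ) tf, HasDirDerivV F (X t) (Y t) (D t))
    (h0 : Tendsto (fun s => s⁻¹ • (Xs s 0 - X 0)) (𝓝[>] (0 : ℝ)) (𝓝 (Y 0))) :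
    Tendsto (fun s => s⁻¹ • (Xs s tf - X tf)) (𝓝[>] (0 : ℝ)) (𝓝 (Y tf)) := by
  have hFc : Continuous F :=
    (LipschitzWith.of_dist_le_mul (K := ⟨L, hL0.le⟩) 
      (fun a b => by rw [dist_eq_norm, dist_eq_norm]; exact hL a b)).continuous
  have hXcont : ContinuousOn X (Icc 0 tf) := fun t ht => (hX t ht).continuousWithinAt
  have hYcont : ContinuousOn Y (Icc 0 tf) := fun t ht => (hY t ht).continuousWithinAt
  obtain ⟨Xc, hXc, hXe⟩ : ∃ Xc : ℝ → E, Continuous Xc ∧ ∀ t ∈ Icc (0 : ℝ) tf, Xc t = X t :=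
    ⟨IccExtend htf.le (domRestrict _ X), hXcont.domRestrict.Icc_extend',
      fun t ht => by rw [IccExtend_of_mem _ _ ht]; rfl⟩
  obtain ⟨Yc, hYc, hYe⟩ : ∃ Xc : ℝ → E, Continuous Xc ∧ ∀ t ∈ Icc (0 : ℝ) tf, Xc t = Y t :=
    ⟨IccExtend htf.le (domRestrict _ Y), hYcont.domRestrict.Icc_extend',
      fun t ht => by rw [IccExtend_of_mem _ _ ht]; rfl⟩
  set q : ℝ → ℝ → E := fun s t => s⁻¹ • (F (Xc t + s • Yc t) - F (Xc t)) with hq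
  have hqc : ∀ s, Continuous (q s) := fun s => by simp only [hq]; fun_prop
  have hqb : ∀ s, 0 < s → ∀ t, ‖q s t‖ ≤ L * ‖Yc t‖ := by
    intro s hs t
    simp only [hq]
    rw [norm_smul, norm_inv, Real.norm_eq_abs, abs_of_pos hs, inv_mul_le_iff₀ hs]
    have := hL (Xc t + s • Yc t) (Xc t)
    rw [add_sub_cancel_left, norm_smul, Real.norm_eq_abs, abs_of_pos hs] at this
    linarith
  have hqt : ∀ t ∈ Icc (0 : ℝ) tf, Tendsto (fun s => q s t) (𝓝[>] 0) (𝓝 (D t)) := by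
    intro t ht
    simp only [hq, hXe t ht, hYe t ht]
    exact hD t ht
  have hDb : ∀ t ∈ Icc (0 : ℝ) tf, ‖D t‖ ≤ L * ‖Yc t‖ := by
    intro t ht
    rw [hYe t ht]
    simpa using (hD t ht).norm_sub_le hL (HasDirDerivV.zero_right F (X t))
  have hDm : MeasureTheory.AEStronglyMeasurable D
      (MeasureTheory.volume.restrict (Ioc 0 tf)) := by
    refine aestronglyMeasurable_of_tendsto_ae (𝓝[>] (0 : ℝ)) (f := q)
      (fun s => (hqc s).aestronglyMeasurable) ?_
    filter_upwards [MeasureTheory.ae_restrict_mem measurableSet_Ioc] with t ht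
    exact hqt t (Ioc_subset_Icc_self ht)
  have hDi : ∀ t ∈ Icc (0 : ℝ) tf, IntervalIntegrable D MeasureTheory.volume 0 t := by
    intro t ht
    have hb : IntervalIntegrable (fun t => L * ‖Yc t‖) MeasureTheory.volume 0 t :=
      (by fun_prop : Continuous (fun t => L * ‖Yc t‖)).intervalIntegrable _ _
    refine hb.mono_fun ?_ ?_
    · rw [uIoc_of_le ht.1]
      exact hDm.mono_measure
        (MeasureTheory.Measure.restrict_mono (Ioc_subset_Ioc_right ht.2) le_rfl)
    · rw [uIoc_of_le ht.1]
      filter_upwards [MeasureTheory.ae_restrict_mem measurableSet_Ioc] with s hs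
      refine (hDb s ⟨hs.1.le, hs.2.trans ht.2⟩).trans (le_abs_self _)
  have hYint : ∀ t ∈ Icc (0 : ℝ) tf, ∫ τ in (0 : ℝ)..t, D τ = Y t - Y 0 := by
    intro t ht
    refine intervalIntegral.integral_eq_sub_of_hasDeriv_right ?_ ?_ (hDi t ht)
    · rw [uIcc_of_le ht.1]
      exact hYcont.mono (Icc_subset_Icc_right ht.2)
    · intro τ hτ
      rw [min_eq_left ht.1, max_eq_right ht.1] at hτ
      have hτ' : τ ∈ Ico (0 : ℝ) tf := ⟨hτ.1.le, hτ.2.trans_le ht.2⟩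
      exact (aux_right hτ' (hY τ (Ico_subset_Icc_self hτ'))).mono Ioi_subset_Ici_self
  set η : ℝ → ℝ := fun s => ∫ τ in (0 : ℝ)..tf, ‖q s τ - D τ‖ with hη
  have hηt : Tendsto η (𝓝[>] 0) (𝓝 0) := by
    have h := intervalIntegral.tendsto_integral_filter_of_dominated_convergence
      (μ := MeasureTheory.volume) (a := 0) (b := tf) (l := 𝓝[>] (0 : ℝ))
      (F := fun s τ => ‖q s τ - D τ‖) (f := fun _ => (0 : ℝ))
      (fun t => L * ‖Yc t‖ + L * ‖Yc t‖) ?_ ?_ ?_ ?_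
    · simpa using h
    · refine Eventually.of_forall fun s => ?_
      rw [uIoc_of_le htf.le]
      exact ((hqc s).aestronglyMeasurable.sub hDm).norm
    · filter_upwards [self_mem_nhdsWithin] with s hs
      refine Eventually.of_forall fun t ht => ?_
      rw [uIoc_of_le htf.le] at ht
      rw [norm_norm]
      exact (norm_sub_le _ _).trans
        (add_le_add (hqb s hs t) (hDb t (Ioc_subset_Icc_self ht)))
    · exact (by fun_prop : Continuous (fun t => L * ‖Yc t‖ + L * ‖Yc t‖)).intervalIntegrable _ _
    · refine Eventually.of_forall fun t ht => ?_
      rw [uIoc_of_le htf.le] at ht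
      have := ((hqt t (Ioc_subset_Icc_self ht)).sub_const (D t)).norm
      simpa using this
  set Z : ℝ → ℝ → E := fun s t => Y 0 + ∫ τ in (0 : ℝ)..t, q s τ with hZ
  have hZd : ∀ s t, HasDerivAt (Z s) (q s t) t := by
    intro s t
    exact ((hqc s).integral_hasStrictDerivAt 0 t).hasDerivAt.const_add (Y 0)
  have hZY : ∀ s, ∀ t ∈ Icc (0 : ℝ) tf, ‖Z s t - Y t‖ ≤ η s := by
    intro s t ht
    have e : Z s t - Y t = ∫ τ in (0 : ℝ)..t, (q s τ - D τ) := by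
      rw [intervalIntegral.integral_sub ((hqc s).intervalIntegrable _ _) (hDi t ht), hYint t ht]
      simp only [hZ]; abel
    rw [e]
    refine (intervalIntegral.norm_integral_le_integral_norm ht.1).trans ?_
    refine intervalIntegral.integral_mono_interval le_rfl ht.1 ht.2 ?_ ?_
    · exact Eventually.of_forall fun _ => norm_nonneg _
    · exact (((hqc s).intervalIntegrable _ _).sub (hDi tf ⟨htf.le, le_rfl⟩)).norm
  -- Gronwall
  have key : ∀ᶠ s in 𝓝[>] (0 : ℝ), ‖s⁻¹ • (Xs s tf - X tf) - Y tf‖ ≤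
      ‖s⁻¹ • (Xs s 0 - X 0) - Y 0‖ * Real.exp (L * tf) + η s * Real.exp (L * tf) := by
    filter_upwards [hXs, self_mem_nhdsWithin] with s hs hs0
    have hs0 : 0 < s := hs0
    have hder : ∀ t ∈ Icc (0 : ℝ) tf, HasDerivWithinAt (fun t => s⁻¹ • (Xs s t - X t) - Z s t)
        (s⁻¹ • (F (Xs s t) - F (X t)) - q s t) (Icc 0 tf) t := fun t ht =>
      (((hs t ht).sub (hX t ht)).const_smul s⁻¹).sub (hZd s t).hasDerivWithinAt
    have hG := norm_le_gronwallBound_of_norm_deriv_right_le (a := 0) (b := tf)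
      (f := fun t => s⁻¹ • (Xs s t - X t) - Z s t)
      (f' := fun t => s⁻¹ • (F (Xs s t) - F (X t)) - q s t)
      (δ := ‖s⁻¹ • (Xs s 0 - X 0) - Y 0‖) (K := L) (ε := L * η s)
      (fun t ht => (hder t ht).continuousWithinAt)
      (fun t ht => aux_right ht (hder t (Ico_subset_Icc_self ht)))
      (by simp [hZ]) ?_ tf ⟨htf.le, le_rfl⟩
    · rw [gronwallBound_of_K_ne_0 hL0.ne'] at hG
      have h1 := hZY s tf ⟨htf.le, le_rfl⟩
      have h2 : s⁻¹ • (Xs s tf - X tf) - Y tf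
        = (s⁻¹ • (Xs s tf - X tf) - Z s tf) + (Z s tf - Y tf) := by abel
      rw [h2]
      refine (norm_add_le _ _).trans ?_
      rw [mul_div_cancel_left₀ _ hL0.ne', sub_zero] at hG
      linarith
    · intro t ht
      have ht' := Ico_subset_Icc_self ht
      have h1 := hZY s t ht'
      have e : s⁻¹ • (F (Xs s t) - F (X t)) - q s t
          = s⁻¹ • (F (Xs s t) - F (X t + s • Y t)) := by
        simp only [hq, hXe t ht', hYe t ht', ← smul_sub]
        congr 1; abel
      rw [e, norm_smul, norm_inv, Real.norm_eq_abs, abs_of_pos hs0, inv_mul_le_iff₀ hs0]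
      refine (hL _ _).trans ?_
      have e2 : Xs s t - (X t + s • Y t)
          = s • ((s⁻¹ • (Xs s t - X t) - Z s t) + (Z s t - Y t)) := by
        rw [sub_add_sub_cancel, smul_sub, smul_smul, mul_inv_cancel₀ hs0.ne', one_smul]; abel
      rw [e2, norm_smul, Real.norm_eq_abs, abs_of_pos hs0]
      have h3 := norm_add_le (s⁻¹ • (Xs s t - X t) - Z s t) (Z s t - Y t)
      have : L * (s * ‖(s⁻¹ • (Xs s t - X t) - Z s t) + (Z s t - Y t)‖)
          ≤ L * (s * (‖s⁻¹ • (Xs s t - X t) - Z s t‖ + η s)) := by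
        gcongr
        linarith
      refine this.trans (le_of_eq ?_)
      ring
  rw [tendsto_iff_norm_sub_tendsto_zero] at h0 ⊢
  refine squeeze_zero' (Eventually.of_forall fun _ => norm_nonneg _) key ?_
  simpa using (h0.mul_const (Real.exp (L * tf))).add (hηt.mul_const (Real.exp (L * tf)))

lemma tube_bound {E : Type*} [NormedAddCommGroup E] [NormedSpace ℝ E]
    {f F : E → E} {L : ℝ} (hL : ∀ a b, ‖F a - F b‖ ≤ L * ‖a - b‖)
    {tf : ℝ} {X U : ℝ → E}
    (hX : ∀ t ∈ Icc (0 : ℝ) tf, HasDerivWithinAt X (f (X t)) (Icc (0 : ℝ) tf) t)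
    (hU : ∀ t ∈ Icc (0 : ℝ) tf, HasDerivWithinAt U (f (U t)) (Icc (0 : ℝ) tf) t)
    (hfF : ∀ t ∈ Icc (0 : ℝ) tf, ∀ z, ‖z - X t‖ ≤ 1 → f z = F z)
    {δ : ℝ} (hL0 : 0 < L) (hδ : 0 < δ) (hδ1 : δ * Real.exp ((L + 1) * tf) ≤ 1)
    (h0 : ‖U 0 - X 0‖ ≤ δ) : ∀ t ∈ Icc (0 : ℝ) tf, ‖U t - X t‖ ≤ 1 := by
  have hB1 : ∀ t ∈ Icc (0 : ℝ) tf, δ * Real.exp ((L + 1) * t) ≤ 1 := by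
    intro t ht
    refine le_trans ?_ hδ1
    have := ht.2
    gcongr
  have hder : ∀ t ∈ Icc (0 : ℝ) tf, HasDerivWithinAt (fun t => U t - X t)
      (f (U t) - f (X t)) (Icc 0 tf) t := fun t ht => (hU t ht).sub (hX t ht)
  have hBd : ∀ t, HasDerivAt (fun t => δ * Real.exp ((L + 1) * t))
      (δ * (Real.exp ((L + 1) * t) * (L + 1))) t := by
    intro t
    have := (((hasDerivAt_id t).const_mul (L + 1)).exp).const_mul δ
    simpa using this
  have := image_norm_le_of_norm_deriv_right_lt_deriv_boundary'
    (f := fun t => U t - X t) (f' := fun t => f (U t) - f (X t)) (a := 0) (b := tf)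
    (fun t ht => (hder t ht).continuousWithinAt)
    (fun t ht => aux_right ht (hder t (Ico_subset_Icc_self ht)))
    (B := fun t => δ * Real.exp ((L + 1) * t))
    (B' := fun t => δ * (Real.exp ((L + 1) * t) * (L + 1)))
    (by simpa using h0) (by fun_prop) (fun t _ => (hBd t).hasDerivWithinAt) ?_
  · exact fun t ht => (this ht).trans (hB1 t ht)
  · intro t ht he
    have ht' := Ico_subset_Icc_self ht
    have he : ‖U t - X t‖ = δ * Real.exp ((L + 1) * t) := he
    rw [hfF t ht' (U t) (he.le.trans (hB1 t ht')), hfF t ht' (X t) (by simp)]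
    refine (hL _ _).trans_lt ?_
    rw [he]
    have : 0 < δ * Real.exp ((L + 1) * t) := by positivity
    nlinarith

lemma dir_chain {E : Type*} [NormedAddCommGroup E] [NormedSpace ℝ E] {g : E → ℝ} {z w : E}
    {K : NNReal} {W : Set E} (hW : W ∈ 𝓝 z) (hg : LipschitzOnWith K g W) {D : ℝ}
    (hD : HasDirDeriv g z w D) {γ : ℝ → E}
    (hγ : Tendsto (fun s : ℝ => s⁻¹ • (γ s - z)) (𝓝[>] (0 : ℝ)) (𝓝 w)) :
    Tendsto (fun s : ℝ => (g (γ s) - g z) / s) (𝓝[>] (0 : ℝ)) (𝓝 D) := by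
  have hid : Tendsto (fun s : ℝ => s) (𝓝[>] (0 : ℝ)) (𝓝 0) := nhdsWithin_le_nhds
  have h1 : Tendsto γ (𝓝[>] 0) (𝓝 z) := by
    have : Tendsto (fun s : ℝ => z + s • (s⁻¹ • (γ s - z))) (𝓝[>] (0 : ℝ)) (𝓝 (z + (0 : ℝ) • w)) :=
      tendsto_const_nhds.add (hid.smul hγ)
    rw [zero_smul, add_zero] at this
    refine this.congr' ?_
    filter_upwards [self_mem_nhdsWithin] with s hs
    have hs : 0 < s := hs
    rw [smul_smul, mul_inv_cancel₀ hs.ne', one_smul, add_sub_cancel]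
  have h2 : Tendsto (fun s : ℝ => z + s • w) (𝓝[>] 0) (𝓝 z) := by
    have : Tendsto (fun s : ℝ => z + s • w) (𝓝[>] (0 : ℝ)) (𝓝 (z + (0 : ℝ) • w)) :=
      tendsto_const_nhds.add (hid.smul tendsto_const_nhds)
    rwa [zero_smul, add_zero] at this
  have h3 : Tendsto (fun s : ℝ => (g (γ s) - g (z + s • w)) / s) (𝓝[>] (0 : ℝ)) (𝓝 0) := by
    refine squeeze_zero_norm' (a := fun s => K * ‖s⁻¹ • (γ s - z) - w‖) ?_ ?_
    · filter_upwards [self_mem_nhdsWithin, h1 hW, h2 hW] with s hs hs1 hs2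
      have hs : 0 < s := hs
      have := hg.dist_le_mul _ hs1 _ hs2
      rw [dist_eq_norm, dist_eq_norm] at this
      rw [norm_div, Real.norm_eq_abs s, abs_of_pos hs, div_le_iff₀ hs]
      refine this.trans (le_of_eq ?_)
      have e : γ s - (z + s • w) = s • (s⁻¹ • (γ s - z) - w) := by
        rw [smul_sub, smul_smul, mul_inv_cancel₀ hs.ne', one_smul]; abel
      rw [e, norm_smul, Real.norm_eq_abs, abs_of_pos hs]
      ring
    · have := (tendsto_iff_norm_sub_tendsto_zero.1 hγ).const_mul (K : ℝ)
      simpa using this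
  have := h3.add hD
  rw [zero_add] at this
  refine this.congr fun s => ?_
  ring

lemma HasDirDeriv.smul_pos {E : Type*} [NormedAddCommGroup E] [NormedSpace ℝ E] {g : E → ℝ}
    {z w : E} {D : ℝ} (hD : HasDirDeriv g z w D) {c : ℝ} (hc : 0 < c) :
    HasDirDeriv g z (c • w) (c * D) := by
  have hlin : Tendsto (fun t : ℝ => t * c) (𝓝[>] 0) (𝓝[>] 0) := by
    refine tendsto_nhdsWithin_iff.2 ⟨?_, ?_⟩
    · have : Continuous (fun t : ℝ => t * c) := by fun_prop
      simpa using (this.tendsto 0).mono_left nhdsWithin_le_nhds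
    · filter_upwards [self_mem_nhdsWithin] with t ht
      exact mul_pos ht hc
  refine ((hD.comp hlin).const_mul c).congr' ?_
  filter_upwards [self_mem_nhdsWithin] with t ht
  have ht : 0 < t := ht
  simp only [Function.comp, smul_smul]
  field_simp

lemma HasDirDeriv.unique {E : Type*} [NormedAddCommGroup E] [NormedSpace ℝ E] {g : E → ℝ}
    {z w : E} {D D' : ℝ} (h : HasDirDeriv g z w D) (h' : HasDirDeriv g z w D') : D = D' :=
  tendsto_nhds_unique h h'

/-- For a function that is Lipschitz near `p`, differences of directional derivatives are
bounded by the Clarke directional derivative. -/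
lemma diff_le_clarke {E : Type*} [NormedAddCommGroup E] [NormedSpace ℝ E] {φ : E → ℝ} {p : E}
    {K : NNReal} {U : Set E} (hU : U ∈ 𝓝 p) (hφ : LipschitzOnWith K φ U) {d v : E} {A B : ℝ}
    (hA : HasDirDeriv φ p (v + d) A) (hB : HasDirDeriv φ p v B) :
    A - B ≤ clarkeDD φ p d := by
  have hid : Tendsto (fun s : ℝ => s) (𝓝[>] (0 : ℝ)) (𝓝 0) := nhdsWithin_le_nhds
  set Q : E × ℝ → ℝ := fun q => (φ (q.1 + q.2 • d) - φ q.1) / q.2 with hQ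
  have hbdd : IsBoundedUnder (· ≤ ·) ((𝓝 p) ×ˢ (𝓝[>] (0 : ℝ))) Q := by
    refine ⟨K * ‖d‖, ?_⟩
    rw [eventually_map]
    have t1 : Tendsto (fun q : E × ℝ => q.1) ((𝓝 p) ×ˢ (𝓝[>] (0 : ℝ))) (𝓝 p) := tendsto_fst
    have t2 : Tendsto (fun q : E × ℝ => q.2) ((𝓝 p) ×ˢ (𝓝[>] (0 : ℝ))) (𝓝[>] 0) := tendsto_snd
    have t3 : Tendsto (fun q : E × ℝ => q.1 + q.2 • d) ((𝓝 p) ×ˢ (𝓝[>] (0 : ℝ))) (𝓝 p) := by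
      have := t1.add ((hid.comp t2).smul (tendsto_const_nhds (x := d)))
      rwa [zero_smul, add_zero] at this
    filter_upwards [t1 hU, t3 hU, t2 self_mem_nhdsWithin] with q h1 h3 h2
    have h2 : 0 < q.2 := h2
    have := hφ.dist_le_mul _ h3 _ h1
    rw [dist_eq_norm, dist_eq_norm, add_sub_cancel_left, norm_smul, Real.norm_eq_abs,
      Real.norm_eq_abs, abs_of_pos h2] at this
    simp only [hQ]
    rw [div_le_iff₀ h2]
    refine (le_abs_self _).trans (this.trans (le_of_eq ?_))
    ring
  have hm : Tendsto (fun t : ℝ => (p + t • v, t)) (𝓝[>] 0) ((𝓝 p) ×ˢ (𝓝[>] (0 : ℝ))) := by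
    refine Tendsto.prodMk ?_ tendsto_id
    have := (tendsto_const_nhds (x := p)).add (hid.smul (tendsto_const_nhds (x := v)))
    rwa [zero_smul, add_zero] at this
  have hlim : Tendsto Q (map (fun t : ℝ => (p + t • v, t)) (𝓝[>] 0)) (𝓝 (A - B)) := by
    rw [tendsto_map'_iff]
    refine (hA.sub hB).congr fun t => ?_
    simp only [hQ, Function.comp, smul_add, ← add_assoc]
    ring
  rw [← hlim.limsup_eq]
  exact limsup_le_limsup_of_le hm hlim.isCoboundedUnder_le hbdd

lemma compass_mem {φ ψ : EuclideanSpace ℝ (Fin 2) → ℝ} {p : EuclideanSpace ℝ (Fin 2)}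
    {K : NNReal} {U : Set (EuclideanSpace ℝ (Fin 2))} (hU : U ∈ 𝓝 p)
    (hφ : LipschitzOnWith K φ U) (hψ : ∀ d, HasDirDeriv φ p d (ψ d)) :
    (∑ i : Fin 2, ((ψ (e2 i) - ψ (-(e2 i))) / 2) • e2 i) ∈ clarkeGrad φ p := by
  have hpos : ∀ c : ℝ, 0 < c → ∀ d, ψ (c • d) = c * ψ d := fun c hc d =>
    (hψ (c • d)).unique ((hψ d).smul_pos hc)
  have hodd : ∀ (c : ℝ) d, ψ (c • d) - ψ (-(c • d)) = c * (ψ d - ψ (-d)) := by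
    intro c d
    rcases lt_trichotomy c 0 with h | h | h
    · have h1 : c • d = (-c) • (-d) := by simp
      have h2 : -(c • d) = (-c) • d := by simp
      rw [h2, h1, hpos _ (by linarith), hpos _ (by linarith)]
      ring
    · simp [h]
    · have h2 : -(c • d) = c • (-d) := by simp
      rw [h2, hpos _ h, hpos _ h]
      ring
  intro d
  have hd : d = d 0 • e2 0 + d 1 • e2 1 := by
    ext i
    fin_cases i <;> simp [e2]
  have hin : ⟪∑ i : Fin 2, ((ψ (e2 i) - ψ (-(e2 i))) / 2) • e2 i, d⟫
      = ((ψ (d 0 • e2 0) - ψ (-(d 0 • e2 0))) + (ψ (d 1 • e2 1) - ψ (-(d 1 • e2 1)))) / 2 := by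
    rw [hodd, hodd, Fin.sum_univ_two, inner_add_left, inner_smul_left, inner_smul_left]
    simp [e2, EuclideanSpace.inner_single_left]
    ring
  rw [hin]
  have h1 := diff_le_clarke hU hφ (d := d) (v := -(d 1 • e2 1)) (hψ _) (hψ _)
  have h2 := diff_le_clarke hU hφ (d := d) (v := -(d 0 • e2 0)) (hψ _) (hψ _)
  have e1 : -(d 1 • e2 1) + d = d 0 • e2 0 := by nth_rewrite 2 [hd]; abel
  have e2' : -(d 0 • e2 0) + d = d 1 • e2 1 := by nth_rewrite 2 [hd]; abel
  rw [e1] at h1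
  rw [e2'] at h2
  linarith

/-- subgradients of cost functions of parametric ODEs with two
parameters.  If `x(·,p)` uniquely solves `dx/dt = f(x)`, `x(0,p) = x₀(p)` on
`[0,t_f]`, `φ(p) = g(p, x(t_f,p))`, and `y(·,d)` solves the directional-derivative
ODE `dy/dt = f'(x(t,p); y(t,d))`, `y(0,d) = x₀'(p;d)`, then (i) `y(·,d)` is the
unique such solution, and (ii) with `ψ(d) := g'((p, x(t_f,p)); (d, y(t_f,d)))`, the
compass difference `½(ψ(1,0) − ψ(−1,0), ψ(0,1) − ψ(0,−1))` lies in `∂φ(p)`. -/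
theorem ode_cost_compass_subgradient
    (n : ℕ)
    (f : EuclideanSpace ℝ (Fin n) → EuclideanSpace ℝ (Fin n))
    (x0 : EuclideanSpace ℝ (Fin 2) → EuclideanSpace ℝ (Fin n))
    (g : EuclideanSpace ℝ (Fin 2) × EuclideanSpace ℝ (Fin n) → ℝ)
    (hfL : LocallyLipschitz f) (hx0L : LocallyLipschitz x0) (hgL : LocallyLipschitz g)
    (hfD : ∀ z w, ∃ L, HasDirDerivV f z w L)
    (hx0D : ∀ q d, ∃ L, HasDirDerivV x0 q d L)
    (hgD : ∀ z w, ∃ L, HasDirDeriv g z w L)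
    (tf : ℝ) (htf : 0 < tf)
    (x : ℝ → EuclideanSpace ℝ (Fin 2) → EuclideanSpace ℝ (Fin n))
    (hxsol : ∀ q, x 0 q = x0 q ∧
      ∀ t ∈ Icc (0 : ℝ) tf,
        HasDerivWithinAt (fun τ => x τ q) (f (x t q)) (Icc (0 : ℝ) tf) t)
    (hxuniq : ∀ q (u : ℝ → EuclideanSpace ℝ (Fin n)),
      (u 0 = x0 q ∧
        ∀ t ∈ Icc (0 : ℝ) tf,
          HasDerivWithinAt u (f (u t)) (Icc (0 : ℝ) tf) t) →
      ∀ t ∈ Icc (0 : ℝ) tf, u t = x t q)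
    (φ : EuclideanSpace ℝ (Fin 2) → ℝ)
    (hφ : φ = fun q => g (q, x tf q))
    (p : EuclideanSpace ℝ (Fin 2))
    (y : ℝ → EuclideanSpace ℝ (Fin 2) → EuclideanSpace ℝ (Fin n))
    (hysol : ∀ d, y 0 d = dirDerivV x0 p d ∧
      ∀ t ∈ Icc (0 : ℝ) tf,
        HasDerivWithinAt (fun τ => y τ d) (dirDerivV f (x t p) (y t d))
          (Icc (0 : ℝ) tf) t)
    (ψ : EuclideanSpace ℝ (Fin 2) → ℝ)
    (hψ : ψ = fun d => dirDeriv g (p, x tf p) (d, y tf d)) :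
    (∀ d (u : ℝ → EuclideanSpace ℝ (Fin n)),
      (u 0 = dirDerivV x0 p d ∧
        ∀ t ∈ Icc (0 : ℝ) tf,
          HasDerivWithinAt u (dirDerivV f (x t p) (u t)) (Icc (0 : ℝ) tf) t) →
      ∀ t ∈ Icc (0 : ℝ) tf, u t = y t d) ∧
    (∑ i : Fin 2, ((ψ (e2 i) - ψ (-(e2 i))) / 2) • e2 i) ∈ clarkeGrad φ p := by
  classical
  have hXd := fun q => (hxsol q).2
  have hXcont : ContinuousOn (fun t => x t p) (Icc 0 tf) :=
    fun t ht => (hXd p t ht).continuousWithinAt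
  -- globally Lipschitz replacement of `f`
  have hcomp : IsCompact (Metric.cthickening 1 ((fun t => x t p) '' Icc 0 tf)) :=
    (isCompact_Icc.image_of_continuousOn hXcont).cthickening
  obtain ⟨K, hK⟩ := LocallyLipschitzOn.exists_lipschitzOnWith_of_compact hcomp
    (hfL.locallyLipschitzOn)
  obtain ⟨F, hF, hfF0⟩ := hK.extend_finite_dimension
  set C : NNReal := lipschitzExtensionConstant (EuclideanSpace ℝ (Fin n)) * K
  have hF1 : LipschitzWith (C + 1) F := hF.weaken (by simp)
  obtain ⟨L, hLdef⟩ : ∃ L : ℝ, L = ((C + 1 : NNReal) : ℝ) := ⟨_, rfl⟩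
  have hL0 : 0 < L := by rw [hLdef]; positivity
  have hL : ∀ a b, ‖F a - F b‖ ≤ L * ‖a - b‖ := by
    intro a b
    have := hF1.dist_le_mul a b
    rwa [dist_eq_norm, dist_eq_norm, ← hLdef] at this
  have hfF : ∀ t ∈ Icc (0 : ℝ) tf, ∀ z, ‖z - x t p‖ ≤ 1 → f z = F z := by
    intro t ht z hz
    refine hfF0 (Metric.mem_cthickening_of_dist_le z (x t p) 1 _ (mem_image_of_mem _ ht) ?_)
    rwa [dist_eq_norm]
  have hDD : ∀ t ∈ Icc (0 : ℝ) tf, ∀ w, HasDirDerivV F (x t p) w (dirDerivV f (x t p) w) := by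
    intro t ht w
    refine (dirDerivV_spec (hfD (x t p) w)).congr_nhds ?_
    filter_upwards [Metric.closedBall_mem_nhds (x t p) one_pos] with z hz
    exact hfF t ht z (by rwa [Metric.mem_closedBall, dist_eq_norm] at hz)
  refine ⟨?_, ?_⟩
  · intro d u hu
    refine ODE_solution_unique_of_mem_Icc_right (v := fun t w => dirDerivV f (x t p) w)
      (s := fun _ => univ) (K := C + 1) ?_
      (fun t ht => (hu.2 t ht).continuousWithinAt)
      (fun t ht => aux_right ht (hu.2 t (Ico_subset_Icc_self ht))) (fun _ _ => mem_univ _)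
      (fun t ht => ((hysol d).2 t ht).continuousWithinAt)
      (fun t ht => aux_right ht ((hysol d).2 t (Ico_subset_Icc_self ht))) (fun _ _ => mem_univ _)
      (by rw [hu.1, (hysol d).1])
    intro t ht
    refine LipschitzOnWith.of_dist_le_mul fun a _ b _ => ?_
    rw [dist_eq_norm, dist_eq_norm, ← hLdef]
    exact (hDD t (Ico_subset_Icc_self ht) a).norm_sub_le hL (hDD t (Ico_subset_Icc_self ht) b)
  -- nearby trajectories stay in the tube
  have hnear : ∀ᶠ q in 𝓝 p, ∀ t ∈ Icc (0 : ℝ) tf,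
      HasDerivWithinAt (fun τ => x τ q) (F (x t q)) (Icc (0 : ℝ) tf) t := by
    have hδ : 0 < Real.exp (-((L + 1) * tf)) := Real.exp_pos _
    filter_upwards [hx0L.continuous.continuousAt.preimage_mem_nhds
      (Metric.closedBall_mem_nhds (x0 p) hδ)] with q hq t ht
    have hq : ‖x 0 q - x 0 p‖ ≤ Real.exp (-((L + 1) * tf)) := by
      rw [(hxsol q).1, (hxsol p).1, ← dist_eq_norm]
      exact hq
    have := tube_bound hL (hXd p) (hXd q) hfF hL0 hδ
      (by rw [← Real.exp_add]; simp) hq t ht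
    rw [← hfF t ht _ this]
    exact hXd q t ht
  obtain ⟨K0, U0, hU0, hx0U⟩ := hx0L p
  obtain ⟨K1, W, hW, hgW⟩ := hgL (p, x tf p)
  have hxLip : ∃ K2 : NNReal, ∃ U ∈ 𝓝 p, LipschitzOnWith K2 (fun q => x tf q) U := by
    refine ⟨K0 * Real.toNNReal (Real.exp (L * tf)), _, inter_mem hU0 hnear, ?_⟩
    refine LipschitzOnWith.of_dist_le_mul fun a ha b hb => ?_
    have h1 := dist_le_of_trajectories_ODE (v := fun _ => F) (K := C + 1) (a := 0) (b := tf)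
      (f := fun t => x t a) (g := fun t => x t b) (δ := dist (x0 a) (x0 b))
      (fun _ => hF1)
      (fun t ht => (ha.2 t ht).continuousWithinAt)
      (fun t ht => aux_right ht (ha.2 t (Ico_subset_Icc_self ht)))
      (fun t ht => (hb.2 t ht).continuousWithinAt)
      (fun t ht => aux_right ht (hb.2 t (Ico_subset_Icc_self ht)))
      (by rw [(hxsol a).1, (hxsol b).1]) tf ⟨htf.le, le_rfl⟩
    rw [← hLdef, sub_zero] at h1
    have h2 := hx0U.dist_le_mul _ ha.1 _ hb.1
    rw [NNReal.coe_mul, Real.coe_toNNReal _ (Real.exp_pos _).le]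
    refine h1.trans ?_
    calc dist (x0 a) (x0 b) * Real.exp (L * tf) ≤ (K0 * dist a b) * Real.exp (L * tf) := by gcongr
      _ = _ := by ring
  obtain ⟨K2, U, hU, hxU⟩ := hxLip
  have hGU : LipschitzOnWith (max 1 K2) (fun q => (q, x tf q)) U :=
    (LipschitzWith.id.lipschitzOnWith).prodMk hxU
  have hGc : ContinuousAt (fun q => (q, x tf q)) p := hGU.continuousOn.continuousAt hU
  have hφL : LipschitzOnWith (K1 * max 1 K2) φ (U ∩ (fun q => (q, x tf q)) ⁻¹' W) := by
    rw [hφ]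
    exact hgW.comp (hGU.mono inter_subset_left) (fun q hq => hq.2)
  refine compass_mem (inter_mem hU (hGc.preimage_mem_nhds hW)) hφL fun d => ?_
  have hid : Tendsto (fun s : ℝ => s) (𝓝[>] (0 : ℝ)) (𝓝 0) := nhdsWithin_le_nhds
  have hline : Tendsto (fun s : ℝ => p + s • d) (𝓝[>] 0) (𝓝 p) := by
    have := (tendsto_const_nhds (x := p)).add (hid.smul (tendsto_const_nhds (x := d)))
    rwa [zero_smul, add_zero] at this
  have hflow := dir_flow hL0 hL htf (X := fun t => x t p) (Y := fun t => y t d)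
    (D := fun t => dirDerivV f (x t p) (y t d)) (Xs := fun s t => x t (p + s • d))
    hnear.self_of_nhds (hline.eventually hnear) (hysol d).2 (fun t ht => hDD t ht _) (by
      simp only [(hxsol _).1, (hysol d).1]
      exact dirDerivV_spec (hx0D p d))
  have hgdir : HasDirDeriv g (p, x tf p) (d, y tf d) (ψ d) := by
    obtain ⟨D, hD⟩ := hgD (p, x tf p) (d, y tf d)
    have : ψ d = D := by rw [hψ]; exact hD.limUnder_eq
    rwa [this]
  have := dir_chain hW hgW hgdir (γ := fun s => (p + s • d, x tf (p + s • d))) (by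
    have h1 : Tendsto (fun s : ℝ => s⁻¹ • (p + s • d - p)) (𝓝[>] (0 : ℝ)) (𝓝 d) := by
      refine tendsto_const_nhds.congr' ?_
      filter_upwards [self_mem_nhdsWithin] with s hs
      have hs : 0 < s := hs
      rw [add_sub_cancel_left, smul_smul, inv_mul_cancel₀ hs.ne', one_smul]
    exact h1.prodMk_nhds hflow)
  rw [hφ]
  exact this
end
end
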